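/- arXiv:math/0609175 — 8 statements merged into one kernel-verified Lean document; each statement's English description precedes it below -/
import Mathlib

section
/- For every natural number n, p(n) = Σ_r t((n − r(r+1)/2)/2), where the sum ranges over all non-negative integers r such that n − r(r+1)/2 is a non-negative even integer. (For example, p(10) = t(5) + t(2) + t(0).) -/
/-- `p n` is the number of partitions of `n`. -/
def p (n : ℕ) : ℕ := Fintype.card (Nat.Partition n)

/-- `t n` is the number of ordered pairs `(μ, ν)` of partitions with `|μ| + |ν| = n`;
equivalently `t n = ∑ p m * p (n - m)`. -/
def t (n : ℕ) : ℕ := ∑ m ∈ Finset.range (n + 1), p m * p (n - m)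

/-- `c = 2 √(π²/6)` is the Hardy–Ramanujan constant. -/
noncomputable def c : ℝ := 2 * Real.sqrt (Real.pi ^ 2 / 6)

section

open Finset PowerSeries

/-- A telescoping identity comparing the right-hand sides of `prod_mul_sum_pow_triangular` for
consecutive values of `n`. -/
lemma sum_pow_mul_prod_sub_eq {R : Type*} [CommRing R] (q : R) {m n : ℕ} (hmn : m ≤ n) :
    ∑ s ∈ range m, q ^ (s * (2 * (n + 1) + 1)) * (∏ k ∈ range s, (1 - q ^ (2 * k + 1))) *
        ∏ k ∈ Ico s (n + 1), (1 - q ^ (2 * k + 2)) -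
      (1 - q ^ (2 * n + 1)) *
        ∑ s ∈ range m, q ^ (s * (2 * n + 1)) * (∏ k ∈ range s, (1 - q ^ (2 * k + 1))) *
          ∏ k ∈ Ico s n, (1 - q ^ (2 * k + 2)) =
    q ^ (m * (2 * n + 1)) * (∏ k ∈ range m, (1 - q ^ (2 * k + 1))) * (1 - q ^ (2 * m)) *
      ∏ k ∈ Ico m n, (1 - q ^ (2 * k + 2)) := by
  induction m with
  | zero => simp
  | succ m ih =>
    have ih := ih (by lia)
    rw [sum_range_succ, sum_range_succ, prod_range_succ, prod_Ico_succ_top (by lia),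
      prod_eq_prod_Ico_succ_bot (show m < n by lia)] at *
    linear_combination ih

/-- A finite form of Gauss's identity for the generating function of the triangular numbers. -/
lemma prod_mul_sum_pow_triangular {R : Type*} [CommRing R] (q : R) (n : ℕ) :
    (∏ k ∈ range n, (1 - q ^ (2 * k + 1))) * ∑ s ∈ range (2 * n), q ^ (s * (s + 1) / 2) =
    ∑ s ∈ range n, q ^ (s * (2 * n + 1)) * (∏ k ∈ range s, (1 - q ^ (2 * k + 1))) *
      ∏ k ∈ Ico s n, (1 - q ^ (2 * k + 2)) := by
  induction n with
  | zero => simp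
  | succ n ih =>
    have htel := sum_pow_mul_prod_sub_eq q (le_refl n)
    have heven : 2 * n * (2 * n + 1) / 2 = n * (2 * n + 1) := by
      rw [mul_assoc, Nat.mul_div_cancel_left _ two_pos]
    have hodd : (2 * n + 1) * (2 * n + 1 + 1) / 2 = n * (2 * n + 1) + (2 * n + 1) := by
      rw [show (2 * n + 1) * (2 * n + 1 + 1) = 2 * (n * (2 * n + 1) + (2 * n + 1)) by ring,
        Nat.mul_div_cancel_left _ two_pos]
    rw [sum_range_succ _ n, show 2 * (n + 1) = 2 * n + 1 + 1 by ring, sum_range_succ,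
      sum_range_succ, heven, hodd, prod_range_succ]
    rw [show 2 * (n + 1) = 2 * n + 1 + 1 by ring] at htel
    simp only [Ico_self, prod_empty, mul_one, Nat.Ico_succ_singleton, prod_singleton] at htel ⊢
    linear_combination (1 - q ^ (2 * n + 1)) * ih - htel

lemma prod_one_sub_pow_two_mul {R : Type*} [CommRing R] (q : R) (n : ℕ) :
    ∏ k ∈ range (2 * n), (1 - q ^ (k + 1)) =
    (∏ k ∈ range n, (1 - q ^ (2 * k + 1))) * ∏ k ∈ range n, (1 - q ^ (2 * k + 2)) := by
  induction n with
  | zero => simp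
  | succ n ih =>
    rw [show 2 * (n + 1) = 2 * n + 1 + 1 by ring, prod_range_succ, prod_range_succ, ih,
      prod_range_succ, prod_range_succ]
    ring

lemma pow_dvd_prod_mul_sum_pow_triangular_sub {R : Type*} [CommRing R] (q : R) {n : ℕ}
    (hn : n ≠ 0) :
    q ^ (2 * n + 1) ∣
      (∏ k ∈ range n, (1 - q ^ (2 * k + 1))) * ∑ s ∈ range (2 * n), q ^ (s * (s + 1) / 2) -
        ∏ k ∈ range n, (1 - q ^ (2 * k + 2)) := by
  obtain ⟨n, rfl⟩ := Nat.exists_eq_succ_of_ne_zero hn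
  rw [prod_mul_sum_pow_triangular, sum_range_succ']
  simp only [zero_mul, pow_zero, range_zero, prod_empty, one_mul, Nat.Ico_zero_eq_range,
    Nat.succ_eq_add_one, add_sub_cancel_right]
  refine dvd_sum fun s _ ↦ ?_
  rw [mul_assoc]
  exact Dvd.dvd.mul_right (pow_dvd_pow q (Nat.le_mul_of_pos_left _ s.succ_pos)) _

/-- The generating function of the partition numbers. -/
noncomputable def partitionSeries : ℤ⟦X⟧ := PowerSeries.mk fun n ↦ (p n : ℤ)

lemma dvd_prod_sub_one {R ι : Type*} [CommRing R] {a : R} {s : Finset ι} {f : ι → R}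
    (h : ∀ i ∈ s, a ∣ f i - 1) : a ∣ ∏ i ∈ s, f i - 1 := by
  classical
  induction s using Finset.induction_on with
  | empty => simp
  | insert i s hi ih =>
    rw [prod_insert hi]
    have h₁ := h i (mem_insert_self i s)
    have h₂ := ih fun j hj ↦ h j (mem_insert_of_mem hj)
    rw [show f i * ∏ j ∈ s, f j - 1 = (f i - 1) * ∏ j ∈ s, f j + (∏ j ∈ s, f j - 1) by ring]
    exact dvd_add (h₁.mul_right _) h₂

open scoped PowerSeries.WithPiTopology in
lemma X_pow_dvd_partitionSeries_mul_prod_sub_one (m : ℕ) :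
    (X : ℤ⟦X⟧) ^ (m + 1) ∣ partitionSeries * ∏ k ∈ range m, (1 - X ^ (k + 1)) - 1 := by
  let f : ℕ → ℤ⟦X⟧ := fun i ↦ ∑' j : ℕ, X ^ ((i + 1) * j)
  have hf (i : ℕ) : f i * (1 - X ^ (i + 1)) = 1 := by
    simp only [f, pow_mul]
    exact WithPiTopology.tsum_pow_mul_one_sub_of_constantCoeff_eq_zero (by simp)
  have hprod : HasProd f partitionSeries := by
    have hmk : partitionSeries =
        PowerSeries.mk fun n ↦ (#(Nat.Partition.restricted n fun _ ↦ True) : ℤ) := by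
      ext n
      simp [partitionSeries, p, Nat.Partition.restricted]
    rw [hmk]
    simpa only [if_true] using
      Nat.Partition.hasProd_powerSeriesMk_card_restricted ℤ fun _ ↦ True
  refine PowerSeries.X_pow_dvd_iff.mpr fun d hd ↦ ?_
  have hlim := (WithPiTopology.tendsto_iff_coeff_tendsto ℤ _ _ _).mp
    (hprod.mul_const (∏ k ∈ range m, (1 - (X : ℤ⟦X⟧) ^ (k + 1)))) d
  rw [map_sub, sub_eq_zero]
  refine tendsto_nhds_unique hlim (tendsto_nhds_of_eventually_eq ?_)
  filter_upwards [Filter.eventually_ge_atTop (range m)] with s hs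
  rw [← prod_sdiff hs, mul_assoc, ← prod_mul_distrib, prod_congr rfl fun i _ ↦ hf i,
    prod_const_one, mul_one, ← sub_eq_zero, ← map_sub]
  refine PowerSeries.X_pow_dvd_iff.mp (dvd_prod_sub_one fun i hi ↦ ?_) d hd
  rw [show f i - 1 = X ^ (i + 1) * f i by linear_combination hf i]
  have him : m ≤ i := by simpa using (mem_sdiff.mp hi).2
  exact (pow_dvd_pow X (by lia)).mul_right _

lemma X_pow_dvd_expand_partitionSeries_mul_prod_sub_one (m : ℕ) :
    (X : ℤ⟦X⟧) ^ (2 * m + 1) ∣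
      expand 2 two_ne_zero partitionSeries * ∏ k ∈ range m, (1 - X ^ (2 * k + 2)) - 1 := by
  have h := map_dvd (expand 2 two_ne_zero) (X_pow_dvd_partitionSeries_mul_prod_sub_one m)
  simp only [map_sub, map_mul, map_prod, map_pow, map_one, expand_X, ← pow_mul, mul_add,
    mul_one] at h
  exact (pow_dvd_pow X (by lia)).trans h

lemma coeff_partitionSeries_sq (n : ℕ) : coeff n (partitionSeries ^ 2) = (t n : ℤ) := by
  rw [sq, coeff_mul, Nat.sum_antidiagonal_eq_sum_range_succ_mk, t]
  simp [partitionSeries]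

/-- Modulo a power of `X`, the partition series is the series of the triangular numbers times the
square of the partition series in `X ^ 2`. -/
lemma X_pow_dvd_sum_mul_expand_sub_partitionSeries {n : ℕ} (hn : n ≠ 0) :
    (X : ℤ⟦X⟧) ^ (2 * n + 1) ∣
      (∑ s ∈ range (2 * n), X ^ (s * (s + 1) / 2)) * expand 2 two_ne_zero (partitionSeries ^ 2) -
        partitionSeries := by
  obtain ⟨a, ha⟩ := pow_dvd_prod_mul_sum_pow_triangular_sub (X : ℤ⟦X⟧) hn
  obtain ⟨b, hb⟩ := X_pow_dvd_partitionSeries_mul_prod_sub_one (2 * n)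
  obtain ⟨e, he⟩ := X_pow_dvd_expand_partitionSeries_mul_prod_sub_one n
  rw [prod_one_sub_pow_two_mul] at hb
  rw [map_pow]
  set ψ : ℤ⟦X⟧ := ∑ s ∈ range (2 * n), X ^ (s * (s + 1) / 2)
  set H := expand 2 two_ne_zero partitionSeries
  set D : ℤ⟦X⟧ := ∏ k ∈ range n, (1 - X ^ (2 * k + 1))
  set N : ℤ⟦X⟧ := ∏ k ∈ range n, (1 - X ^ (2 * k + 2))
  refine ⟨partitionSeries * N * H ^ 2 * a - ψ * H ^ 2 * b + partitionSeries * (H * N + 1) * e, ?_⟩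
  linear_combination partitionSeries * N * H ^ 2 * ha - ψ * H ^ 2 * hb +
    partitionSeries * (H * N + 1) * he

end

/-- `p n = ∑_r t((n − r(r+1)/2)/2)`, the sum being over all non-negative integers `r`
such that `n − r(r+1)/2` is a non-negative even integer. -/
theorem partition_core_quotient_recurrence (n : ℕ) :
    p n = ∑ r ∈ (Finset.range (n + 1)).filter
        (fun r => r * (r + 1) / 2 ≤ n ∧ 2 ∣ (n - r * (r + 1) / 2)),
      t ((n - r * (r + 1) / 2) / 2) := by
  have h := PowerSeries.X_pow_dvd_iff.mp
    (X_pow_dvd_sum_mul_expand_sub_partitionSeries n.succ_ne_zero) n (by lia)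
  rw [map_sub, sub_eq_zero, Finset.sum_mul, map_sum] at h
  have hp : PowerSeries.coeff n partitionSeries = (p n : ℤ) := by simp [partitionSeries]
  rw [← Nat.cast_inj (R := ℤ), Nat.cast_sum, ← hp, ← h, Finset.sum_filter]
  symm
  refine (Finset.sum_congr rfl fun r _ ↦ ?_).trans
    (Finset.sum_subset (Finset.range_mono (by lia)) fun r _ hr ↦ ?_)
  · rw [PowerSeries.coeff_X_pow_mul', PowerSeries.coeff_expand, ite_and]
    simp only [coeff_partitionSeries_sq]
  · rw [PowerSeries.coeff_X_pow_mul', if_neg]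
    rw [Finset.mem_range, not_lt] at hr
    rw [not_le, Nat.lt_iff_add_one_le, Nat.le_div_iff_mul_le two_pos]
    nlinarith
end

section
/- For every natural number n ≥ 1, p(n) ≤ n · t(⌊n/2⌋). -/
/-- Adds to every entry of a list its position. -/
def stair (l : List ℕ) : List ℕ := l.mapIdx fun i x => x + i

/-- Subtracts from every entry of a list its position. -/
def unstair (l : List ℕ) : List ℕ := l.mapIdx fun i x => x - i

@[simp] lemma length_stair (l : List ℕ) : (stair l).length = l.length := by simp [stair]

@[simp] lemma length_unstair (l : List ℕ) : (unstair l).length = l.length := by simp [unstair]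

lemma unstair_stair (l : List ℕ) : unstair (stair l) = l := by
  apply List.ext_getElem <;> simp [stair, unstair]

lemma sum_mapIdx_add (l : List ℕ) (c : ℕ) :
    (l.mapIdx fun i x => x + (i + c)).sum = l.sum + l.length.choose 2 + l.length * c := by
  induction l generalizing c with
  | nil => simp
  | cons a l ih =>
    have h := ih (c + 1)
    simp only [List.mapIdx_cons, List.sum_cons, List.length_cons, Nat.choose_succ_succ' _ 1,
      Nat.choose_one_right, add_assoc, add_comm 1 c] at h ⊢
    rw [h]
    ring

lemma sum_stair (l : List ℕ) : (stair l).sum = l.sum + l.length.choose 2 := by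
  simpa [stair] using sum_mapIdx_add l 0

lemma pairwise_stair {l : List ℕ} (hl : l.Pairwise (· ≤ ·)) : (stair l).Pairwise (· < ·) := by
  rw [List.pairwise_iff_getElem] at hl ⊢
  intro i j hi hj hij
  have := hl i j (by simpa using hi) (by simpa using hj) hij
  simp only [stair, List.getElem_mapIdx]
  lia

lemma getElem_add_le_getElem_add {l : List ℕ} (hl : l.Pairwise (· < ·)) (i d : ℕ)
    (h : i + d < l.length) : l[i] + d ≤ l[i + d] := by
  induction d with
  | zero => simp
  | succ d ih =>
    have h₁ := ih (by lia)
    have h₂ := List.pairwise_iff_getElem.1 hl (i + d) (i + (d + 1)) (by lia) h (by lia)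
    lia

lemma le_getElem_of_pairwise_lt {l : List ℕ} (hl : l.Pairwise (· < ·)) (i : ℕ)
    (h : i < l.length) : i ≤ l[i] := by
  have := getElem_add_le_getElem_add hl 0 i (by simpa using h)
  simp only [zero_add] at this
  lia

lemma stair_unstair {l : List ℕ} (hl : l.Pairwise (· < ·)) : stair (unstair l) = l := by
  apply List.ext_getElem
  · simp
  · intro i _ h
    simpa [stair, unstair] using Nat.sub_add_cancel (le_getElem_of_pairwise_lt hl i h)

lemma pairwise_unstair {l : List ℕ} (hl : l.Pairwise (· < ·)) :
    (unstair l).Pairwise (· ≤ ·) := by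
  rw [List.pairwise_iff_getElem]
  intro i j hi hj hij
  obtain ⟨d, rfl⟩ := Nat.exists_eq_add_of_lt hij
  have := getElem_add_le_getElem_add hl i (d + 1) (by simpa [add_assoc] using hj)
  simp only [unstair, List.getElem_mapIdx]
  simp only [← add_assoc] at this
  lia

lemma pairwise_lt_sort (X : Finset ℕ) : X.sort.Pairwise (· < ·) := X.sortedLT_sort.pairwise

lemma sum_eq_sum_unstair_add_choose (X : Finset ℕ) :
    ∑ x ∈ X, x = (unstair X.sort).sum + X.card.choose 2 := by
  have h := sum_stair (unstair X.sort)
  rw [stair_unstair (pairwise_lt_sort X), length_unstair, Finset.length_sort] at h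
  rw [← h, ← Multiset.sum_coe, Finset.sort_eq, Finset.sum_eq_multiset_sum, Multiset.map_id']

lemma choose_two_le_sum (X : Finset ℕ) : X.card.choose 2 ≤ ∑ x ∈ X, x :=
  sum_eq_sum_unstair_add_choose X ▸ Nat.le_add_left _ _

lemma eq_of_filter_ne_zero_eq {s u : Multiset ℕ} (hc : s.card = u.card)
    (h : s.filter (· ≠ 0) = u.filter (· ≠ 0)) : s = u := by
  have key (v : Multiset ℕ) :
      v = Multiset.replicate (v.card - (v.filter (· ≠ 0)).card) 0 + v.filter (· ≠ 0) := by
    have hv := Multiset.filter_add_not (· = 0) v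
    have hcard := congrArg Multiset.card hv
    rw [Multiset.card_add] at hcard
    rw [← hcard, Nat.add_sub_cancel]
    conv_lhs => rw [← hv]
    rw [← Multiset.eq_replicate_card.2 fun b hb => (Multiset.mem_filter.1 hb).2]
  rw [key s, key u, h, hc]

/-- A set of `k` natural numbers with sum `m + 0 + 1 + ⋯ + (k - 1)` is determined by a partition
of `m`. -/
lemma card_le_p (S : Finset (Finset ℕ)) (k m : ℕ)
    (hS : ∀ X ∈ S, X.card = k ∧ ∑ x ∈ X, x = m + k.choose 2) : S.card ≤ p m := by
  have hmaps (X : S) : (unstair X.1.sort : Multiset ℕ).sum = m := by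
    have h := sum_eq_sum_unstair_add_choose X.1
    rw [(hS X.1 X.2).1, (hS X.1 X.2).2] at h
    rw [Multiset.sum_coe]
    lia
  rw [← Fintype.card_coe]
  refine Fintype.card_le_of_injective
    (fun X : S => Nat.Partition.ofSums m (unstair X.1.sort) (hmaps X)) fun X Y h => ?_
  have h' : (unstair X.1.sort : Multiset ℕ) = unstair Y.1.sort := by
    apply eq_of_filter_ne_zero_eq
    · simp [(hS X.1 X.2).1, (hS Y.1 Y.2).1]
    · simpa using congrArg Nat.Partition.parts h
  have hl := (Multiset.coe_eq_coe.1 h').eq_of_pairwise'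
    (pairwise_unstair (pairwise_lt_sort _)) (pairwise_unstair (pairwise_lt_sort _))
  have hs := congrArg stair hl
  rw [stair_unstair (pairwise_lt_sort _), stair_unstair (pairwise_lt_sort _)] at hs
  rw [Subtype.ext_iff, ← Finset.sort_toFinset X.1 (· ≤ ·), hs, Finset.sort_toFinset]

lemma card_parts_le {n : ℕ} (a : n.Partition) : a.parts.card ≤ n := by
  have := Multiset.card_nsmul_le_sum (s := a.parts) (a := 1) fun _ hx => a.parts_pos hx
  simpa [a.parts_sum] using this

/-- The parts of a partition of `n` in increasing order, padded with zeros to length `n`. -/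
def paddedParts {n : ℕ} (a : n.Partition) : List ℕ :=
  (a.parts + Multiset.replicate (n - a.parts.card) 0).sort

lemma coe_paddedParts {n : ℕ} (a : n.Partition) :
    (paddedParts a : Multiset ℕ) = a.parts + Multiset.replicate (n - a.parts.card) 0 :=
  Multiset.sort_eq _ _

lemma length_paddedParts {n : ℕ} (a : n.Partition) : (paddedParts a).length = n := by
  rw [← Multiset.coe_card, coe_paddedParts]
  simpa using Nat.add_sub_cancel' (card_parts_le a)

lemma sum_paddedParts {n : ℕ} (a : n.Partition) : (paddedParts a).sum = n := by
  rw [← Multiset.sum_coe, coe_paddedParts]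
  simp [a.parts_sum]

lemma paddedParts_injective (n : ℕ) :
    Function.Injective (paddedParts : n.Partition → List ℕ) := by
  have key (a : n.Partition) : (paddedParts a : Multiset ℕ).filter (· ≠ 0) = a.parts := by
    rw [coe_paddedParts, Multiset.filter_add, Multiset.filter_eq_self.2
      fun _ hx => (a.parts_pos hx).ne', Multiset.filter_eq_nil.2, add_zero]
    intro x hx
    simpa using Multiset.eq_of_mem_replicate hx
  intro a b h
  ext1
  rw [← key a, ← key b, h]

/-- The set of beta-numbers of a partition of `n` padded with zeros to length `n`. -/
def betaSet {n : ℕ} (a : n.Partition) : Finset ℕ := (stair (paddedParts a)).toFinset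

lemma pairwise_stair_paddedParts {n : ℕ} (a : n.Partition) :
    (stair (paddedParts a)).Pairwise (· < ·) :=
  pairwise_stair (Multiset.pairwise_sort _ _)

lemma betaSet_injective (n : ℕ) : Function.Injective (betaSet : n.Partition → Finset ℕ) := by
  have key (a : n.Partition) : (betaSet a).sort = stair (paddedParts a) :=
    (List.toFinset_sort (· ≤ ·) ((pairwise_stair_paddedParts a).imp ne_of_lt)).2
      ((pairwise_stair_paddedParts a).imp le_of_lt)
  intro a b h
  apply paddedParts_injective
  rw [← unstair_stair (paddedParts a), ← key, h, key, unstair_stair]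

lemma card_betaSet {n : ℕ} (a : n.Partition) : (betaSet a).card = n := by
  rw [betaSet, List.toFinset_card_of_nodup ((pairwise_stair_paddedParts a).imp ne_of_lt),
    length_stair, length_paddedParts]

lemma sum_betaSet {n : ℕ} (a : n.Partition) : ∑ x ∈ betaSet a, x = n + n.choose 2 := by
  rw [betaSet, List.sum_toFinset _ ((pairwise_stair_paddedParts a).imp ne_of_lt), List.map_id',
    sum_stair, length_paddedParts, sum_paddedParts]

/-- The halves of the even elements of a set. -/
def evenHalf (X : Finset ℕ) : Finset ℕ := (X.filter Even).image (· / 2)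

/-- The halves, rounded down, of the odd elements of a set. -/
def oddHalf (X : Finset ℕ) : Finset ℕ := (X.filter (¬ Even ·)).image (· / 2)

lemma injOn_div_two_even (X : Finset ℕ) : Set.InjOn (· / 2) (X.filter Even : Set ℕ) := by
  intro x hx y hy h
  simp only [Finset.coe_filter, Set.mem_ofPred_eq, Nat.even_iff] at hx hy h
  lia

lemma injOn_div_two_odd (X : Finset ℕ) : Set.InjOn (· / 2) (X.filter (¬ Even ·) : Set ℕ) := by
  intro x hx y hy h
  simp only [Finset.coe_filter, Set.mem_ofPred_eq, Nat.even_iff] at hx hy h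
  lia

lemma card_evenHalf_add_card_oddHalf (X : Finset ℕ) :
    (evenHalf X).card + (oddHalf X).card = X.card := by
  rw [evenHalf, oddHalf, Finset.card_image_of_injOn (injOn_div_two_even X),
    Finset.card_image_of_injOn (injOn_div_two_odd X), Finset.card_filter_add_card_filter_not]

lemma sum_eq_sum_evenHalf_add_sum_oddHalf (X : Finset ℕ) :
    ∑ x ∈ X, x = 2 * ∑ x ∈ evenHalf X, x + (2 * ∑ x ∈ oddHalf X, x + (oddHalf X).card) := by
  rw [Finset.card_eq_sum_ones, Finset.mul_sum, Finset.mul_sum, ← Finset.sum_add_distrib,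
    evenHalf, oddHalf, Finset.sum_image (injOn_div_two_even X),
    Finset.sum_image (injOn_div_two_odd X), ← Finset.sum_filter_add_sum_filter_not X Even]
  congr 1 <;> refine Finset.sum_congr rfl fun x hx => ?_
  all_goals
    have := (Finset.mem_filter.1 hx).2
    rw [Nat.even_iff] at this
    lia

lemma evenHalf_oddHalf_injective :
    Function.Injective fun X : Finset ℕ => (evenHalf X, oddHalf X) := by
  have hE (X : Finset ℕ) (x : ℕ) : x ∈ evenHalf X ↔ 2 * x ∈ X := by
    simp only [evenHalf, Finset.mem_image, Finset.mem_filter, Nat.even_iff]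
    constructor
    · rintro ⟨y, ⟨hy, h⟩, rfl⟩
      rwa [show 2 * (y / 2) = y by lia]
    · exact fun h => ⟨2 * x, ⟨h, by lia⟩, by lia⟩
  have hO (X : Finset ℕ) (x : ℕ) : x ∈ oddHalf X ↔ 2 * x + 1 ∈ X := by
    simp only [oddHalf, Finset.mem_image, Finset.mem_filter, Nat.even_iff]
    constructor
    · rintro ⟨y, ⟨hy, h⟩, rfl⟩
      rwa [show 2 * (y / 2) + 1 = y by lia]
    · exact fun h => ⟨2 * x + 1, ⟨h, by lia⟩, by lia⟩
  intro X Y h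
  obtain ⟨h₁, h₂⟩ := Prod.mk.inj h
  ext x
  rcases Nat.even_or_odd' x with ⟨y, rfl | rfl⟩
  · rw [← hE, ← hE, h₁]
  · rw [← hO, ← hO, h₂]

lemma p_mono : Monotone p := by
  refine monotone_nat_of_le_succ fun n => ?_
  refine Fintype.card_le_of_injective (fun a : n.Partition =>
    (⟨1 ::ₘ a.parts, ?_, ?_⟩ : (n + 1).Partition)) fun a b h => ?_
  · intro i hi
    rcases Multiset.mem_cons.1 hi with rfl | hi
    exacts [one_pos, a.parts_pos hi]
  · rw [Multiset.sum_cons, a.parts_sum, add_comm]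
  · ext1
    exact (Multiset.cons_inj_right 1).1 (congrArg Nat.Partition.parts h)

lemma t_mono : Monotone t := by
  refine monotone_nat_of_le_succ fun n => ?_
  rw [t, t, Finset.sum_range_succ _ (n + 1)]
  refine le_add_right (Finset.sum_le_sum fun i _ => Nat.mul_le_mul_left _ (p_mono (by lia)))

/-- Pairs of sets of prescribed cardinalities and total sum are determined by pairs of
partitions. -/
lemma card_le_t (S : Finset (Finset ℕ × Finset ℕ)) (k l m : ℕ)
    (hS : ∀ X ∈ S, X.1.card = k ∧ X.2.card = l ∧
      ∑ x ∈ X.1, x + ∑ x ∈ X.2, x = m + k.choose 2 + l.choose 2) : S.card ≤ t m := by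
  have hk : ∀ X ∈ S, k.choose 2 ≤ ∑ x ∈ X.1, x := fun X hX => by
    simpa [(hS X hX).1] using choose_two_le_sum X.1
  have hl : ∀ X ∈ S, l.choose 2 ≤ ∑ x ∈ X.2, x := fun X hX => by
    simpa [(hS X hX).2.1] using choose_two_le_sum X.2
  have hmaps : ∀ X ∈ S, ∑ x ∈ X.1, x - k.choose 2 ∈ Finset.range (m + 1) := fun X hX => by
    have h₁ := hk X hX
    have h₂ := hl X hX
    have h₃ := (hS X hX).2.2
    rw [Finset.mem_range]
    lia
  rw [Finset.card_eq_sum_card_fiberwise hmaps, t]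
  refine Finset.sum_le_sum fun i hi => ?_
  rw [Finset.mem_range] at hi
  set F := S.filter fun X => ∑ x ∈ X.1, x - k.choose 2 = i
  calc F.card ≤ (F.image Prod.fst ×ˢ F.image Prod.snd).card :=
        Finset.card_le_card Finset.subset_product
    _ = (F.image Prod.fst).card * (F.image Prod.snd).card := Finset.card_product _ _
    _ ≤ p i * p (m - i) := by
      refine Nat.mul_le_mul (card_le_p _ k i fun Y hY => ?_) (card_le_p _ l (m - i) fun Y hY => ?_)
      all_goals
        obtain ⟨X, hX, rfl⟩ := Finset.mem_image.1 hY
        obtain ⟨hXS, hXi⟩ := Finset.mem_filter.1 hX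
        have h₁ := hk X hXS
        have h₂ := hl X hXS
        obtain ⟨h₃, h₄, h₅⟩ := hS X hXS
      · exact ⟨h₃, by lia⟩
      · exact ⟨h₄, by lia⟩

lemma choose_two_add_le (k l : ℕ) :
    (k + l).choose 2 ≤ 2 * (k.choose 2 + l.choose 2) + l := by
  have h : ((k - l : ℤ) : ℚ) ≤ ((k - l : ℤ) ^ 2 : ℤ) := Int.cast_le.2 (Int.le_self_sq _)
  rw [← Nat.cast_le (α := ℚ)]
  push_cast [Nat.cast_choose_two] at h ⊢
  linarith

/-- The number of partitions with a given 2-core is at most `t (n / 2)`. -/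
lemma card_fiber_le (n k : ℕ) :
    (Finset.univ.filter fun a : n.Partition => (evenHalf (betaSet a)).card = k).card
      ≤ t (n / 2) := by
  set F := Finset.univ.filter fun a : n.Partition => (evenHalf (betaSet a)).card = k
  rcases F.eq_empty_or_nonempty with h | ⟨a₀, ha₀⟩
  · simp [h]
  have key : ∀ a ∈ F, ∃ l, k + l = n ∧ (oddHalf (betaSet a)).card = l ∧
      n + n.choose 2 = 2 * (∑ x ∈ evenHalf (betaSet a), x + ∑ x ∈ oddHalf (betaSet a), x) + l ∧
      k.choose 2 + l.choose 2 ≤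
        ∑ x ∈ evenHalf (betaSet a), x + ∑ x ∈ oddHalf (betaSet a), x := fun a ha => by
    have hk : (evenHalf (betaSet a)).card = k := (Finset.mem_filter.1 ha).2
    have h₁ := card_evenHalf_add_card_oddHalf (betaSet a)
    have h₂ := sum_eq_sum_evenHalf_add_sum_oddHalf (betaSet a)
    have h₃ := choose_two_le_sum (evenHalf (betaSet a))
    have h₄ := choose_two_le_sum (oddHalf (betaSet a))
    rw [card_betaSet, hk] at h₁
    rw [sum_betaSet] at h₂
    rw [hk] at h₃
    exact ⟨_, h₁, rfl, by lia, by lia⟩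
  obtain ⟨l, hkl, -, hsum, hle⟩ := key a₀ ha₀
  obtain ⟨m, hm⟩ := Nat.exists_eq_add_of_le hle
  have hcore : n.choose 2 ≤ 2 * (k.choose 2 + l.choose 2) + l := hkl ▸ choose_two_add_le k l
  refine le_trans ?_ (t_mono (show m ≤ n / 2 by lia))
  rw [← Finset.card_image_of_injective F
    (evenHalf_oddHalf_injective.comp (betaSet_injective n))]
  refine card_le_t _ k l m fun X hX => ?_
  obtain ⟨a, ha, rfl⟩ := Finset.mem_image.1 hX
  obtain ⟨l', hkl', hl', hsum', -⟩ := key a ha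
  obtain rfl : l' = l := by lia
  exact ⟨(Finset.mem_filter.1 ha).2, hl', by simp only [Function.comp]; lia⟩

/-- For every `n ≥ 1`, `p n ≤ n * t ⌊n/2⌋`. -/
theorem p_le_mul_t (n : ℕ) (hn : 1 ≤ n) : p n ≤ n * t (n / 2) := by
  rcases hn.eq_or_lt with rfl | hn
  · decide
  have hmaps : ∀ a ∈ (Finset.univ : Finset n.Partition),
      (evenHalf (betaSet a)).card ∈ Finset.Icc 1 n := fun a _ => by
    have h₁ := card_evenHalf_add_card_oddHalf (betaSet a)
    have h₂ := sum_eq_sum_evenHalf_add_sum_oddHalf (betaSet a)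
    have h₃ := choose_two_le_sum (oddHalf (betaSet a))
    rw [card_betaSet] at h₁
    rw [sum_betaSet] at h₂
    rw [Finset.mem_Icc]
    refine ⟨Nat.pos_of_ne_zero fun h => ?_, by lia⟩
    have h₄ : (oddHalf (betaSet a)).card = n := by lia
    rw [h₄] at h₂ h₃
    have h₅ : 0 < n.choose 2 := Nat.choose_pos hn
    lia
  calc p n = (Finset.univ : Finset n.Partition).card := rfl
    _ = ∑ k ∈ Finset.Icc 1 n,
        (Finset.univ.filter fun a : n.Partition => (evenHalf (betaSet a)).card = k).card :=
      Finset.card_eq_sum_card_fiberwise hmaps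
    _ ≤ ∑ _k ∈ Finset.Icc 1 n, t (n / 2) := Finset.sum_le_sum fun k _ => card_fiber_le n k
    _ = n * t (n / 2) := by simp
end

section
/- Suppose f : ℝ_{≥0} → ℝ_{≥0} is an increasing (monotone) function such that f(0) ≥ 1 and, for all natural numbers n ≥ 1, Σ_{s=0}^{⌊n/2⌋} f(n/2 − s)·f(s) ≤ f(n)/n (the sum being over integers s with 0 ≤ s ≤ n/2). Then p(n) ≤ f(n) for all natural numbers n ≥ 1. -/
/-- Half of each even part of `s`. -/
def evenHalves (s : Multiset ℕ) : Multiset ℕ := (s.filter Even).map (· / 2)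

/-- Half (rounded down) of each odd part of `s`, with the resulting zeros removed. -/
def oddHalves (s : Multiset ℕ) : Multiset ℕ :=
  ((s.filter fun k => ¬ Even k).map (· / 2)).filter (0 < ·)

theorem eq_evenHalves_add_oddHalves_add_replicate (s : Multiset ℕ) :
    s = (evenHalves s).map (2 * ·) + (oddHalves s).map (2 * · + 1) +
      Multiset.replicate (s.count 1) 1 := by
  induction s using Multiset.induction_on with
  | empty => simp [evenHalves, oddHalves]
  | cons k s ih =>
    conv_lhs => rw [ih]
    by_cases hk : Even k
    · have hne : 1 ≠ k := by rintro rfl; simp at hk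
      simp [evenHalves, oddHalves, hk, Multiset.count_cons_of_ne hne,
        Nat.two_mul_div_two_of_even hk]
    · have hk' : 2 * (k / 2) + 1 = k :=
        Nat.two_mul_div_two_add_one_of_odd (Nat.not_even_iff_odd.1 hk)
      by_cases h1 : k = 1
      · subst h1
        simp [evenHalves, oddHalves, Multiset.replicate_succ]
      · have hpos : 0 < k / 2 := by omega
        rw [Multiset.count_cons_of_ne (Ne.symm h1)]
        simp only [evenHalves, oddHalves, hk, not_false_eq_true, Multiset.filter_cons_of_pos,
          Multiset.filter_cons_of_neg, Multiset.map_cons, hpos, hk']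
        simp

theorem sum_eq_two_mul_halves (s : Multiset ℕ) :
    s.sum = 2 * (evenHalves s).sum + (2 * (oddHalves s).sum + (oddHalves s).card) + s.count 1 := by
  have hdouble (u : Multiset ℕ) : (u.map (2 * ·)).sum = 2 * u.sum := by
    simpa only [id, Multiset.map_id'] using Multiset.sum_map_mul_left (s := u) (a := 2) (f := id)
  conv_lhs => rw [eq_evenHalves_add_oddHalves_add_replicate s]
  rw [Multiset.sum_add, Multiset.sum_add, hdouble, Multiset.sum_map_add, hdouble]
  simp

/-- The partitions of `n`, as multisets of parts. -/
def partitionParts (n : ℕ) : Finset (Multiset ℕ) :=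
  (Finset.univ : Finset (Nat.Partition n)).image Nat.Partition.parts

theorem card_partitionParts (n : ℕ) : (partitionParts n).card = p n :=
  Finset.card_image_of_injective _ fun _ _ h => Nat.Partition.ext h

theorem mem_partitionParts {n : ℕ} {s : Multiset ℕ} :
    s ∈ partitionParts n ↔ (∀ k ∈ s, 0 < k) ∧ s.sum = n := by
  simp only [partitionParts, Finset.mem_image, Finset.mem_univ, true_and]
  constructor
  · rintro ⟨l, rfl⟩
    exact ⟨fun _ => l.parts_pos, l.parts_sum⟩
  · rintro ⟨hpos, hsum⟩
    exact ⟨⟨s, hpos _, hsum⟩, rfl⟩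

/-- Splitting a partition of `n` into even and odd parts and halving them. -/
theorem p_le_sum_t (n : ℕ) : p n ≤ ∑ i ∈ Finset.range (n / 2 + 1), t i := by
  classical
  have hcard : p n ≤ ((Finset.range (n / 2 + 1)).biUnion fun i =>
      (Finset.range (i + 1)).biUnion fun a =>
        partitionParts a ×ˢ partitionParts (i - a)).card := by
    rw [← card_partitionParts]
    refine Finset.card_le_card_of_injOn (fun s => (evenHalves s, oddHalves s)) ?_ ?_
    · intro s hs
      obtain ⟨hpos, hsum⟩ := mem_partitionParts.1 hs
      have h := sum_eq_two_mul_halves s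
      simp only [Finset.coe_biUnion, Set.mem_iUnion, Finset.mem_coe, Finset.mem_range,
        Finset.mem_product, mem_partitionParts]
      refine ⟨(evenHalves s).sum + (oddHalves s).sum, by omega, (evenHalves s).sum, by omega,
        ⟨?_, rfl⟩, ?_, by omega⟩
      · intro k hk
        simp only [evenHalves, Multiset.mem_map, Multiset.mem_filter] at hk
        obtain ⟨j, ⟨hj, ⟨r, hr⟩⟩, rfl⟩ := hk
        have := hpos j hj
        omega
      · intro k hk
        exact (Multiset.mem_filter.1 hk).2
    · intro s hs u hu hsu
      obtain ⟨he, ho⟩ := Prod.mk.inj hsu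
      have hs' := (mem_partitionParts.1 hs).2
      have hu' := (mem_partitionParts.1 hu).2
      have h₁ := sum_eq_two_mul_halves s
      have h₂ := sum_eq_two_mul_halves u
      rw [he, ho] at h₁
      have hc : s.count 1 = u.count 1 := by omega
      rw [eq_evenHalves_add_oddHalves_add_replicate s, he, ho, hc,
        ← eq_evenHalves_add_oddHalves_add_replicate u]
  refine hcard.trans (Finset.card_biUnion_le.trans (Finset.sum_le_sum fun i _ =>
    Finset.card_biUnion_le.trans (le_of_eq ?_)))
  simp [t, card_partitionParts]

/-- If `f : ℝ≥0 → ℝ≥0` is increasing, `f 0 ≥ 1` and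
`∑_{s=0}^{⌊n/2⌋} f(n/2 − s) f(s) ≤ f(n)/n` for all `n ≥ 1`, then `p n ≤ f n` for all `n ≥ 1`. -/
theorem p_le_of_superadditive_bound (f : NNReal → NNReal) (hmono : Monotone f)
    (hf0 : 1 ≤ f 0)
    (hrec : ∀ n : ℕ, 1 ≤ n →
      ∑ s ∈ Finset.range (n / 2 + 1), f ((n : NNReal) / 2 - (s : NNReal)) * f (s : NNReal) ≤
        f (n : NNReal) / (n : NNReal)) :
    ∀ n : ℕ, 1 ≤ n → (p n : NNReal) ≤ f (n : NNReal) := by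
  intro n
  induction n using Nat.strong_induction_on with
  | _ n ih =>
    intro hn
    have hlt : ∀ m < n, (p m : NNReal) ≤ f m := by
      intro m hm
      rcases Nat.eq_zero_or_pos m with rfl | hpos
      · simpa [p] using hf0
      · exact ih m hm hpos
    have ht : ∀ i ∈ Finset.range (n / 2 + 1), (t i : NNReal) ≤ f n / n := by
      intro i hi
      have hi' : i ≤ n / 2 := Nat.lt_succ_iff.1 (Finset.mem_range.1 hi)
      refine le_trans ?_ (hrec n hn)
      rw [t, Nat.cast_sum]
      refine (Finset.sum_le_sum fun a ha => ?_).trans (Finset.sum_le_sum_of_subset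
        (Finset.range_mono (Nat.succ_le_succ hi')))
      have ha' : a ≤ i := Nat.lt_succ_iff.1 (Finset.mem_range.1 ha)
      rw [Nat.cast_mul, mul_comm]
      refine mul_le_mul' ((hlt _ (by omega)).trans (hmono ?_)) (hlt a (by omega))
      rw [Nat.cast_tsub]
      refine tsub_le_tsub_right ?_ _
      exact (Nat.cast_le.2 hi').trans Nat.cast_div_le
    have hn0 : (n : NNReal) ≠ 0 := by exact_mod_cast (by omega : n ≠ 0)
    calc (p n : NNReal) ≤ ∑ i ∈ Finset.range (n / 2 + 1), (t i : NNReal) := by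
          exact_mod_cast p_le_sum_t n
      _ ≤ (n / 2 + 1 : ℕ) * (f n / n) := by
          simpa using Finset.sum_le_card_nsmul _ _ _ ht
      _ ≤ n * (f n / n) := by
          gcongr
          omega
      _ = f n := mul_div_cancel₀ _ hn0
end

section
/- For every natural number m, p(4m) ≥ p(m)². -/
/-- Twice the parts of `a`, then `2 * k - 1` and `1` for each part `k` of `b`. The even members
recover `a` and the odd ones recover `b`. -/
def interleaveParts (a b : Multiset ℕ) : Multiset ℕ :=
  a.map (2 * ·) + (b.map (2 * · - 1) + Multiset.replicate b.card 1)

theorem sum_interleaveParts (a b : Multiset ℕ) (hb : ∀ k ∈ b, 0 < k) :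
    (interleaveParts a b).sum = 2 * a.sum + 2 * b.sum := by
  have h : (b.map (2 * · - 1)).sum + b.card = 2 * b.sum := by
    induction b using Multiset.induction_on with
    | empty => simp
    | cons k s ih =>
      have hs := ih fun i hi => hb i (Multiset.mem_cons_of_mem hi)
      have hk := hb k (Multiset.mem_cons_self k s)
      simp only [Multiset.map_cons, Multiset.sum_cons, Multiset.card_cons]
      omega
  have ha : (a.map (2 * ·)).sum = 2 * a.sum := by
    simpa using Multiset.sum_map_mul_left (s := a) (a := 2) (f := id)
  simp [interleaveParts, ha, h]

theorem pos_of_mem_interleaveParts {a b : Multiset ℕ} (ha : ∀ k ∈ a, 0 < k)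
    (hb : ∀ k ∈ b, 0 < k) {i : ℕ} (hi : i ∈ interleaveParts a b) : 0 < i := by
  simp only [interleaveParts, Multiset.mem_add, Multiset.mem_map, Multiset.mem_replicate] at hi
  rcases hi with ⟨k, hk, rfl⟩ | ⟨k, hk, rfl⟩ | ⟨-, rfl⟩
  · have := ha k hk
    omega
  · have := hb k hk
    omega
  · exact one_pos

theorem filter_even_interleaveParts (a b : Multiset ℕ) (hb : ∀ k ∈ b, 0 < k) :
    (interleaveParts a b).filter Even = a.map (2 * ·) := by
  have hodd : (b.map (2 * · - 1) + Multiset.replicate b.card 1).filter Even = 0 := by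
    refine Multiset.filter_eq_nil.2 fun i hi => ?_
    simp only [Multiset.mem_add, Multiset.mem_map, Multiset.mem_replicate] at hi
    rw [Nat.even_iff]
    rcases hi with ⟨k, hk, rfl⟩ | ⟨-, rfl⟩
    · have := hb k hk
      omega
    · norm_num
  have heven : (a.map (2 * ·)).filter Even = a.map (2 * ·) := by
    refine Multiset.filter_eq_self.2 fun i hi => ?_
    obtain ⟨k, -, rfl⟩ := Multiset.mem_map.1 hi
    exact even_two_mul k
  rw [interleaveParts, Multiset.filter_add, heven, hodd, add_zero]

theorem map_half_map_two_mul_sub_one (b : Multiset ℕ) (hb : ∀ k ∈ b, 0 < k) :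
    (b.map (2 * · - 1)).map (fun i => (i + 1) / 2) = b := by
  rw [Multiset.map_map]
  conv_rhs => rw [← Multiset.map_id b]
  refine Multiset.map_congr rfl fun k hk => ?_
  have := hb k hk
  simp only [Function.comp_apply, id_eq]
  omega

theorem interleaveParts_inj {a b a' b' : Multiset ℕ} (hb : ∀ k ∈ b, 0 < k)
    (hb' : ∀ k ∈ b', 0 < k) (h : interleaveParts a b = interleaveParts a' b') :
    a = a' ∧ b = b' := by
  have ha : a.map (2 * ·) = a'.map (2 * ·) := by
    rw [← filter_even_interleaveParts a b hb, h, filter_even_interleaveParts a' b' hb']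
  rw [interleaveParts, interleaveParts, ha, add_right_inj] at h
  have hcard : b.card = b'.card := by
    have := congrArg Multiset.card h
    simp only [Multiset.card_add, Multiset.card_map, Multiset.card_replicate] at this
    omega
  rw [hcard, add_left_inj] at h
  refine ⟨Multiset.map_injective (mul_right_injective₀ two_ne_zero) ha, ?_⟩
  rw [← map_half_map_two_mul_sub_one b hb, h, map_half_map_two_mul_sub_one b' hb']

/-- The partition of `4 * m` obtained from a pair of partitions of `m`. -/
def Nat.Partition.interleave {m : ℕ} (q : m.Partition × m.Partition) : (4 * m).Partition where
  parts := interleaveParts q.1.parts q.2.parts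
  parts_pos := pos_of_mem_interleaveParts (fun _ => q.1.parts_pos) (fun _ => q.2.parts_pos)
  parts_sum := by
    rw [sum_interleaveParts _ _ fun _ => q.2.parts_pos, q.1.parts_sum, q.2.parts_sum]
    ring

theorem Nat.Partition.interleave_injective (m : ℕ) :
    Function.Injective (Nat.Partition.interleave (m := m)) := by
  intro q r h
  obtain ⟨h₁, h₂⟩ := interleaveParts_inj (fun _ => q.2.parts_pos) (fun _ => r.2.parts_pos)
    (congrArg Nat.Partition.parts h)
  exact Prod.ext (Nat.Partition.ext h₁) (Nat.Partition.ext h₂)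

/-- For every natural number `m`, `p (4m) ≥ p m ^ 2`. -/
theorem p_four_mul_ge (m : ℕ) : p m ^ 2 ≤ p (4 * m) := by
  rw [p, p, sq, ← Fintype.card_prod]
  exact Fintype.card_le_of_injective _ (Nat.Partition.interleave_injective m)
end

section
/- For every natural number n ≥ 4, log p(n) ≥ (log 5 / 4) · √n; equivalently, p(n) ≥ 5^{√n / 4}. -/
lemma two_mul_sum_Icc_two (k : ℕ) : 2 * ∑ i ∈ Finset.Icc 2 (k + 1), i = k * (k + 3) := by
  induction k with
  | zero => simp
  | succ k ih =>
    rw [Finset.sum_Icc_succ_top (by omega), mul_add, ih]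
    ring

/-- The partition of `n` with distinct parts `s` completed by ones. -/
def partitionWithOnes (n : ℕ) (s : Finset ℕ) (hs : ∀ i ∈ s, 2 ≤ i) (hsum : ∑ i ∈ s, i ≤ n) :
    Nat.Partition n where
  parts := s.val + Multiset.replicate (n - ∑ i ∈ s, i) 1
  parts_pos := by
    intro i hi
    rcases Multiset.mem_add.1 hi with h | h
    · have := hs i h
      omega
    · rw [Multiset.eq_of_mem_replicate h]
      exact one_pos
  parts_sum := by
    have h : s.val.sum = ∑ i ∈ s, i := Finset.sum_val s
    rw [Multiset.sum_add, Multiset.sum_replicate, h, smul_eq_mul, mul_one]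
    omega

lemma mem_partitionWithOnes {n : ℕ} {s : Finset ℕ} (hs : ∀ i ∈ s, 2 ≤ i)
    (hsum : ∑ i ∈ s, i ≤ n) (i : ℕ) :
    i ∈ s ↔ i ∈ (partitionWithOnes n s hs hsum).parts ∧ i ≠ 1 := by
  simp only [partitionWithOnes, Multiset.mem_add, Multiset.mem_replicate, Finset.mem_val]
  constructor
  · intro h
    have := hs i h
    exact ⟨Or.inl h, by omega⟩
  · rintro ⟨h | h, h1⟩
    · exact h
    · exact absurd h.2 h1

/-- If `k (k + 3) / 2 ≤ n`, completing subsets of `{2, …, k + 1}` by ones gives `2 ^ k`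
partitions of `n`. -/
lemma two_pow_le_p {n k : ℕ} (h : k * (k + 3) ≤ 2 * n) : 2 ^ k ≤ p n := by
  have hmem (s : (Finset.Icc 2 (k + 1)).powerset) : ∀ i ∈ s.1, 2 ≤ i := fun i hi =>
    (Finset.mem_Icc.1 (Finset.mem_powerset.1 s.2 hi)).1
  have hsum (s : (Finset.Icc 2 (k + 1)).powerset) : ∑ i ∈ s.1, i ≤ n := by
    have h₁ := Finset.sum_le_sum_of_subset (f := fun i : ℕ => i) (Finset.mem_powerset.1 s.2)
    have h₂ := two_mul_sum_Icc_two k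
    omega
  have hinj : Function.Injective fun s => partitionWithOnes n s.1 (hmem s) (hsum s) := by
    intro s u hsu
    ext i
    rw [mem_partitionWithOnes (hmem s) (hsum s), mem_partitionWithOnes (hmem u) (hsum u)]
    simp only at hsu
    rw [hsu]
  simpa [p] using Fintype.card_le_of_injective _ hinj

lemma three_mul_log_five_le : 3 * Real.log 5 ≤ 7 * Real.log 2 := by
  have h : Real.log ((5 : ℝ) ^ 3) ≤ Real.log ((2 : ℝ) ^ 7) :=
    Real.log_le_log (by norm_num) (by norm_num)
  simpa using h

lemma three_le_p_four : 3 ≤ p 4 :=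
  Finset.card_le_univ
    ({Nat.Partition.ofSums 4 {4} rfl, Nat.Partition.ofSums 4 {3, 1} rfl,
      Nat.Partition.ofSums 4 {2, 2} rfl} : Finset (Nat.Partition 4))

/-- For every `n ≥ 4`, `log p(n) ≥ (log 5 / 4) √n`. -/
theorem log_p_ge (n : ℕ) (hn : 4 ≤ n) :
    Real.log 5 / 4 * Real.sqrt n ≤ Real.log (p n) := by
  rcases hn.eq_or_lt with rfl | hn
  · have hsqrt : Real.sqrt ((4 : ℕ) : ℝ) = 2 := by
      rw [Real.sqrt_eq_iff_mul_self_eq] <;> norm_num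
    have h₅ : Real.log 5 ≤ Real.log ((3 : ℝ) ^ 2) := Real.log_le_log (by norm_num) (by norm_num)
    have h₃ : Real.log 3 ≤ Real.log (p 4) :=
      Real.log_le_log (by norm_num) (by exact_mod_cast three_le_p_four)
    rw [Real.log_pow] at h₅
    push_cast at h₅
    rw [hsqrt]
    linarith
  obtain ⟨k, hk, hle, hlt⟩ : ∃ k, 2 ≤ k ∧ k * (k + 3) ≤ 2 * n ∧
      2 * n < (k + 1) * (k + 1 + 3) := by
    let P : ℕ → Prop := fun k => k * (k + 3) ≤ 2 * n
    have h2 : P 2 := by simp only [P]; omega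
    have h2n : 2 ≤ 2 * n := by omega
    refine ⟨Nat.findGreatest P (2 * n), Nat.le_findGreatest h2n h2,
      Nat.findGreatest_spec h2n h2, ?_⟩
    by_contra! hcon
    have hbound : Nat.findGreatest P (2 * n) + 1 ≤ 2 * n := by nlinarith
    have := Nat.le_findGreatest (P := P) hbound hcon
    omega
  have hsqrt : Real.sqrt n ≤ 12 / 7 * k := by
    apply Real.sqrt_le_iff.2 ⟨by positivity, ?_⟩
    have hk' : (2 : ℝ) ≤ k := by exact_mod_cast hk
    have hlt' : (2 : ℝ) * n + 1 ≤ (k + 1) * (k + 1 + 3) := by exact_mod_cast hlt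
    nlinarith
  have hlog2 : 0 < Real.log 2 := Real.log_pos (by norm_num)
  calc Real.log 5 / 4 * Real.sqrt n ≤ 7 / 12 * Real.log 2 * (12 / 7 * k) := by
        have := three_mul_log_five_le
        gcongr
        linarith
    _ = Real.log ((2 : ℝ) ^ k) := by rw [Real.log_pow]; ring
    _ ≤ Real.log (p n) := by
        apply Real.log_le_log (by positivity)
        exact_mod_cast two_pow_le_p hle
end

section
/- Let c = 2√(π²/6) and let b be a real number such that p(n) ∼ e^{c√n}/(b·n) as n → ∞. Then t(n) ∼ (e^{c√(2n)} / n^{5/4}) · (2²·3^{1/4} / b²) as n → ∞; that is, t(n)·b²·n^{5/4} / (4·3^{1/4}·e^{c√(2n)}) → 1. -/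
open Filter

open MeasureTheory Set Topology

/-- A finite sum is the integral of a step function, after an affine change of variables. -/
lemma sum_range_eq_mul_integral (g : ℕ → ℝ) (N : ℕ) (a : ℝ) {s : ℝ} (hs : 0 < s) :
    ∑ m ∈ Finset.range N, g m =
      ∫ x, (Ico (0 : ℝ) N).indicator (fun y => s * g ⌊y⌋₊) (a + s * x) := by
  have hstep : (Ico (0 : ℝ) N).indicator (fun y => s * g ⌊y⌋₊) = fun y =>
      ∑ m ∈ Finset.range N, (Ico (m : ℝ) (m + 1)).indicator (fun _ => s * g m) y := by
    funext y
    by_cases hy : y ∈ Ico (0 : ℝ) N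
    · rw [indicator_of_mem hy, Finset.sum_eq_single_of_mem ⌊y⌋₊]
      · rw [indicator_of_mem]
        exact ⟨Nat.floor_le hy.1, Nat.lt_floor_add_one y⟩
      · rw [Finset.mem_range]
        exact (Nat.floor_lt hy.1).2 hy.2
      · intro m _ hm
        refine indicator_of_notMem (fun h => hm ?_) _
        exact ((Nat.floor_eq_iff hy.1).2 h).symm
    · rw [indicator_of_notMem hy, Finset.sum_eq_zero]
      intro m hm
      refine indicator_of_notMem (fun h => hy ⟨(Nat.cast_nonneg m).trans h.1, h.2.trans_le ?_⟩) _
      exact_mod_cast Finset.mem_range.1 hm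
  have hint : ∫ y, (Ico (0 : ℝ) N).indicator (fun y => s * g ⌊y⌋₊) y =
      s * ∑ m ∈ Finset.range N, g m := by
    rw [hstep, integral_finsetSum, Finset.mul_sum]
    · refine Finset.sum_congr rfl fun m _ => ?_
      rw [integral_indicator_const _ measurableSet_Ico]
      simp
    · intro m _
      exact (integrable_indicator_iff measurableSet_Ico).2
        (integrableOn_const measure_Ico_lt_top.ne)
  rw [Measure.integral_comp_mul_left
    (fun z => (Ico (0 : ℝ) N).indicator (fun y => s * g ⌊y⌋₊) (a + z)) s,
    integral_add_left_eq_self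
      (fun y => (Ico (0 : ℝ) N).indicator (fun y => s * g ⌊y⌋₊) y) a, hint,
    abs_of_pos (inv_pos.2 hs), smul_eq_mul, inv_mul_cancel_left₀ hs.ne']

/-- The denominator in the second-order expansion of `√μ + √(1 - μ)` around `μ = 1 / 2`. -/
noncomputable def sqrtDefect (μ : ℝ) : ℝ :=
  (2 * √(μ * (1 - μ)) + 1) * (√μ + √(1 - μ) + √2)

lemma sqrtDefect_pos (μ : ℝ) : 0 < sqrtDefect μ := by
  unfold sqrtDefect
  positivity

lemma sqrtDefect_le {μ : ℝ} (h0 : 0 ≤ μ) (h1 : μ ≤ 1) : sqrtDefect μ ≤ 12 := by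
  have e1 : √(μ * (1 - μ)) ≤ 1 := Real.sqrt_le_one.2 (by nlinarith)
  have e2 : √μ ≤ 1 := Real.sqrt_le_one.2 h1
  have e3 : √(1 - μ) ≤ 1 := Real.sqrt_le_one.2 (by linarith)
  have e4 : √2 ≤ 2 := (Real.sqrt_le_left (by norm_num)).2 (by norm_num)
  calc sqrtDefect μ ≤ (2 * 1 + 1) * (1 + 1 + 2) := by unfold sqrtDefect; gcongr
    _ = 12 := by norm_num

lemma sqrtDefect_half : sqrtDefect (1 / 2) = 4 * √2 := by
  have h : √(1 / 2 : ℝ) = √2 / 2 := by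
    rw [Real.sqrt_eq_iff_mul_self_eq (by norm_num) (by positivity)]
    nlinarith [Real.mul_self_sqrt (show (0 : ℝ) ≤ 2 by norm_num)]
  have h' : √((1 / 2 : ℝ) * (1 / 2)) = 1 / 2 := Real.sqrt_mul_self (by norm_num)
  unfold sqrtDefect
  rw [show (1 : ℝ) - 1 / 2 = 1 / 2 by norm_num, h, h']
  ring

lemma continuous_sqrtDefect : Continuous sqrtDefect := by
  unfold sqrtDefect
  fun_prop

lemma sqrt_add_sqrt_one_sub {μ : ℝ} (h0 : 0 ≤ μ) (h1 : μ ≤ 1) :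
    √μ + √(1 - μ) - √2 = -(4 * (μ - 1 / 2) ^ 2 / sqrtDefect μ) := by
  rw [← neg_div, eq_div_iff (sqrtDefect_pos μ).ne']
  have e1 := Real.sq_sqrt h0
  have e2 := Real.sq_sqrt (sub_nonneg.2 h1)
  have e3 := Real.sq_sqrt (show (0 : ℝ) ≤ 2 by norm_num)
  unfold sqrtDefect
  rw [Real.sqrt_mul h0]
  generalize √μ = u at *
  generalize √(1 - μ) = v at *
  generalize √2 = w at *
  have hv : v ^ 2 = 1 - u ^ 2 := by rw [e2, e1]
  subst e1
  linear_combination (4 * u ^ 2 + 2 * u * v + 1) * hv - (2 * u * v + 1) * e3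

lemma rpow_three_quarters_sq {x : ℝ} (hx : 0 < x) :
    (x ^ (3 / 4 : ℝ)) ^ 2 * √x = x ^ 2 := by
  rw [Real.sqrt_eq_rpow, ← Real.rpow_natCast, ← Real.rpow_mul hx.le, ← Real.rpow_add hx,
    ← Real.rpow_natCast]
  norm_num

/-- Exact form of the Gaussian profile of `√m + √(n - m)` around `m = n / 2`. -/
lemma sqrt_add_sqrt_sub {n m : ℝ} (hn : 0 < n) (h0 : 0 ≤ m) (h1 : m ≤ n) :
    √m + √(n - m) - √(2 * n) =
      -(4 * ((m - n / 2) / n ^ (3 / 4 : ℝ)) ^ 2 / sqrtDefect (m / n)) := by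
  have e1 : √m = √(m / n) * √n := by
    rw [← Real.sqrt_mul (by positivity), div_mul_cancel₀ _ hn.ne']
  have e2 : √(n - m) = √(1 - m / n) * √n := by
    rw [← Real.sqrt_mul (sub_nonneg.2 ((div_le_one hn).2 h1)), sub_mul,
      div_mul_cancel₀ _ hn.ne', one_mul]
  have e3 : √(2 * n) = √2 * √n := Real.sqrt_mul (by norm_num) _
  have hd := (sqrtDefect_pos (m / n)).ne'
  have hp : n ^ (3 / 4 : ℝ) ≠ 0 := (Real.rpow_pos_of_pos hn _).ne'
  have key : (m / n - 1 / 2) ^ 2 * √n = ((m - n / 2) / n ^ (3 / 4 : ℝ)) ^ 2 := by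
    rw [div_pow, eq_div_iff (pow_ne_zero 2 hp), mul_assoc, mul_comm (√n),
      rpow_three_quarters_sq hn, ← mul_pow]
    congr 1
    field_simp
  rw [e1, e2, e3, ← key, ← add_mul, ← sub_mul,
    sqrt_add_sqrt_one_sub (by positivity) ((div_le_one hn).2 h1)]
  ring

/-- The rational weight of the convolution is controlled by a quartic in the rescaled variable. -/
lemma sq_div_le_quartic {n m : ℝ} (hn : 0 < n) (h0 : 0 ≤ m) (h1 : m ≤ n) :
    n ^ 2 / ((m + 1) * (n - m + 1)) ≤ 16 + 256 * ((m - n / 2) / n ^ (3 / 4 : ℝ)) ^ 4 := by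
  have hd : 0 < (m + 1) * (n - m + 1) := mul_pos (by linarith) (by linarith)
  have hp : (n ^ (3 / 4 : ℝ)) ^ 4 = n ^ 3 := by
    rw [← Real.rpow_natCast, ← Real.rpow_mul hn.le, ← Real.rpow_natCast]
    norm_num
  rw [div_pow, hp]
  rcases le_or_gt (|m - n / 2|) (n / 4) with h | h
  · have h' := abs_le.1 h
    have : n ^ 2 / ((m + 1) * (n - m + 1)) ≤ 16 := by
      rw [div_le_iff₀ hd]
      have : n / 4 * (n / 4) ≤ (m + 1) * (n - m + 1) := by
        apply mul_le_mul <;> linarith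
      linarith
    have : 0 ≤ 256 * ((m - n / 2) ^ 4 / n ^ 3) := by positivity
    linarith
  · have e1 : n ^ 2 / ((m + 1) * (n - m + 1)) ≤ n := by
      rw [div_le_iff₀ hd]
      nlinarith [mul_nonneg hn.le (mul_nonneg h0 (sub_nonneg.2 h1))]
    have e2 : n ≤ 256 * ((m - n / 2) ^ 4 / n ^ 3) := by
      rw [← mul_div_assoc, le_div_iff₀ (by positivity)]
      have := pow_le_pow_left₀ (by positivity) h.le 4
      rw [(show Even 4 by decide).pow_abs] at this
      nlinarith
    linarith

lemma quartic_mul_exp_le {a : ℝ} (ha : 0 < a) {x κ : ℝ} (h : |κ - x| ≤ 1) :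
    (16 + 256 * κ ^ 4) * Real.exp (-(a / 3) * κ ^ 2) ≤
      (16 + 256 * (72 / a ^ 2)) * Real.exp (a / 6) * Real.exp (-(a / 12) * x ^ 2) := by
  have hκ : κ ^ 4 ≤ 72 / a ^ 2 * Real.exp (a / 6 * κ ^ 2) := by
    have := Real.quadratic_le_exp_of_nonneg (show 0 ≤ a / 6 * κ ^ 2 by positivity)
    rw [div_mul_eq_mul_div, le_div_iff₀ (by positivity)]
    nlinarith [show 0 ≤ a / 6 * κ ^ 2 by positivity]
  have h1 : 1 ≤ Real.exp (a / 6 * κ ^ 2) := Real.one_le_exp (by positivity)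
  calc (16 + 256 * κ ^ 4) * Real.exp (-(a / 3) * κ ^ 2)
      ≤ ((16 + 256 * (72 / a ^ 2)) * Real.exp (a / 6 * κ ^ 2)) *
          Real.exp (-(a / 3) * κ ^ 2) := by
        gcongr
        nlinarith
    _ = (16 + 256 * (72 / a ^ 2)) * Real.exp (-(a / 6) * κ ^ 2) := by
        rw [mul_assoc, ← Real.exp_add]
        ring_nf
    _ ≤ (16 + 256 * (72 / a ^ 2)) * Real.exp (a / 6 + -(a / 12) * x ^ 2) := by
        gcongr
        have h2 := abs_le.1 h
        have : x ^ 2 ≤ 2 * κ ^ 2 + 2 := by nlinarith [sq_nonneg (κ + (κ - x))]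
        nlinarith
    _ = _ := by rw [Real.exp_add, mul_assoc]

/-- Pointwise form of the convolution summand in terms of normalized sequences. -/
lemma rescaled_summand_eq {u : ℕ → ℝ} {a : ℝ} {n m : ℕ} (hn : 0 < n) (hm : m ≤ n) :
    (n : ℝ) ^ (3 / 4 : ℝ) *
        (u m * u (n - m) * (n : ℝ) ^ (5 / 4 : ℝ) / Real.exp (a * √(2 * n))) =
      (u m * (m + 1) / Real.exp (a * √m)) *
        (u (n - m) * ((n - m : ℕ) + 1) / Real.exp (a * √(n - m : ℕ))) *
        ((n : ℝ) ^ 2 / (((m : ℝ) + 1) * (n - m + 1))) *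
        Real.exp (-(4 * a * (((m : ℝ) - n / 2) / (n : ℝ) ^ (3 / 4 : ℝ)) ^ 2 /
          sqrtDefect (m / n))) := by
  have hn' : (0 : ℝ) < n := by exact_mod_cast hn
  have hm' : (m : ℝ) ≤ n := by exact_mod_cast hm
  have hs := sqrt_add_sqrt_sub hn' (Nat.cast_nonneg m) hm'
  have he : -(4 * a * (((m : ℝ) - n / 2) / (n : ℝ) ^ (3 / 4 : ℝ)) ^ 2 / sqrtDefect (m / n)) =
      a * √m + a * √((n : ℝ) - m) - a * √(2 * n) := by
    linear_combination (-a) * hs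
  have hpow : (n : ℝ) ^ (3 / 4 : ℝ) * (n : ℝ) ^ (5 / 4 : ℝ) = (n : ℝ) ^ 2 := by
    rw [← Real.rpow_add hn', ← Real.rpow_natCast]
    norm_num
  rw [he, Real.exp_sub, Real.exp_add, Nat.cast_sub hm, ← hpow]
  have h1 : (m : ℝ) + 1 ≠ 0 := by positivity
  have h2 : (n : ℝ) - m + 1 ≠ 0 := by linarith
  field_simp

lemma abs_floor_sub_le_one {y : ℝ} (hy : 0 ≤ y) : |(⌊y⌋₊ : ℝ) - y| ≤ 1 := by
  have := Nat.floor_le hy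
  have := Nat.lt_floor_add_one y
  rw [abs_le]
  constructor <;> linarith

/-- The rescaled offset of `⌊n / 2 + s x⌋₊` from `n / 2` is close to `x`. -/
lemma abs_floor_offset_sub_le {n s x : ℝ} (hs : 0 < s) (hy : 0 ≤ n / 2 + s * x) :
    |((⌊n / 2 + s * x⌋₊ : ℝ) - n / 2) / s - x| ≤ 1 / s := by
  have h : ((⌊n / 2 + s * x⌋₊ : ℝ) - n / 2) / s - x =
      ((⌊n / 2 + s * x⌋₊ : ℝ) - (n / 2 + s * x)) / s := by
    field_simp
    ring
  rw [h, abs_div, abs_of_pos hs]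
  gcongr
  exact abs_floor_sub_le_one hy

lemma tendsto_normalized_succ {u : ℕ → ℝ} {a : ℝ}
    (hu : Tendsto (fun n : ℕ => u n * n / Real.exp (a * √n)) atTop (𝓝 1)) :
    Tendsto (fun n : ℕ => u n * (n + 1) / Real.exp (a * √n)) atTop (𝓝 1) := by
  have h1 : Tendsto (fun n : ℕ => 1 + 1 / (n : ℝ)) atTop (𝓝 1) := by
    simpa using tendsto_one_div_atTop_nhds_zero_nat.const_add (1 : ℝ)
  have h2 := hu.mul h1
  rw [one_mul] at h2
  refine h2.congr' ?_
  filter_upwards [eventually_gt_atTop 0] with n hn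
  have : (n : ℝ) ≠ 0 := by positivity
  field_simp

lemma tendsto_natCast_rpow_three_quarters :
    Tendsto (fun n : ℕ => (n : ℝ) ^ (3 / 4 : ℝ)) atTop atTop :=
  (tendsto_rpow_atTop (by norm_num)).comp tendsto_natCast_atTop_atTop

/-- The midpoint scaling: `n / 2 + n ^ (3 / 4) x` is asymptotic to `n / 2`. -/
lemma tendsto_half_add_div (x : ℝ) :
    Tendsto (fun n : ℕ => ((n : ℝ) / 2 + (n : ℝ) ^ (3 / 4 : ℝ) * x) / n) atTop (𝓝 (1 / 2)) := by
  have h : Tendsto (fun n : ℕ => (n : ℝ) ^ (-(1 / 4) : ℝ)) atTop (𝓝 0) :=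
    (tendsto_rpow_neg_atTop (by norm_num)).comp tendsto_natCast_atTop_atTop
  have h2 := (h.mul_const x).const_add (1 / 2)
  rw [zero_mul, add_zero] at h2
  refine h2.congr' ?_
  filter_upwards [eventually_gt_atTop 0] with n hn
  have hn' : (0 : ℝ) < n := by exact_mod_cast hn
  have : (n : ℝ) ^ (3 / 4 : ℝ) = (n : ℝ) ^ (-(1 / 4) : ℝ) * n := by
    rw [← Real.rpow_add_one hn'.ne']
    norm_num
  rw [this]
  field_simp

/-- The self-convolution of a sequence asymptotic to `exp (a √n) / n`, by Laplace's method. -/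
theorem tendsto_convolution_exp_sqrt {u : ℕ → ℝ} {a : ℝ} (ha : 0 < a)
    (hu : Tendsto (fun n : ℕ => u n * n / Real.exp (a * √n)) atTop (𝓝 1)) :
    Tendsto (fun n : ℕ => (∑ m ∈ Finset.range (n + 1), u m * u (n - m)) *
        (n : ℝ) ^ (5 / 4 : ℝ) / Real.exp (a * √(2 * n)))
      atTop (𝓝 (4 * √(Real.pi / (a / √2)))) := by
  have hr := tendsto_normalized_succ hu
  set r : ℕ → ℝ := fun n => u n * (n + 1) / Real.exp (a * √n)
  obtain ⟨C, hC⟩ : ∃ C, ∀ n, |r n| ≤ C := by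
    obtain ⟨C, hC⟩ := hr.abs.bddAbove_range
    exact ⟨C, fun n => hC (mem_range_self n)⟩
  have hC0 : 0 ≤ C := (abs_nonneg _).trans (hC 0)
  set G : ℕ → ℕ → ℝ := fun n m =>
    u m * u (n - m) * (n : ℝ) ^ (5 / 4 : ℝ) / Real.exp (a * √(2 * n)) with hG
  set F : ℕ → ℝ → ℝ := fun n x => (Ico (0 : ℝ) (n + 1 : ℕ)).indicator
    (fun y => (n : ℝ) ^ (3 / 4 : ℝ) * G n ⌊y⌋₊) ((n : ℝ) / 2 + (n : ℝ) ^ (3 / 4 : ℝ) * x) with hF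
  have hFmeas : ∀ n, AEStronglyMeasurable (F n) volume := by
    intro n
    have h1 : Measurable fun y : ℝ => (n : ℝ) ^ (3 / 4 : ℝ) * G n ⌊y⌋₊ :=
      ((measurable_from_nat (f := G n)).comp Nat.measurable_floor).const_mul _
    exact ((h1.indicator measurableSet_Ico).comp (by fun_prop)).aestronglyMeasurable
  have hbound : ∀ᶠ n in atTop, ∀ᵐ x ∂volume, ‖F n x‖ ≤
      C * C * ((16 + 256 * (72 / a ^ 2)) * Real.exp (a / 6) * Real.exp (-(a / 12) * x ^ 2)) := by
    filter_upwards [eventually_gt_atTop 0] with n hn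
    refine Eventually.of_forall fun x => ?_
    have hn' : (0 : ℝ) < n := by exact_mod_cast hn
    have hs1 : (1 : ℝ) ≤ (n : ℝ) ^ (3 / 4 : ℝ) :=
      Real.one_le_rpow (by exact_mod_cast hn) (by norm_num)
    by_cases hy : (n : ℝ) / 2 + (n : ℝ) ^ (3 / 4 : ℝ) * x ∈ Ico (0 : ℝ) (n + 1 : ℕ)
    · have hm : ⌊(n : ℝ) / 2 + (n : ℝ) ^ (3 / 4 : ℝ) * x⌋₊ ≤ n :=
        Nat.lt_succ_iff.1 ((Nat.floor_lt hy.1).2 hy.2)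
      have hκ := (abs_floor_offset_sub_le (by linarith) hy.1).trans
        ((div_le_one (by linarith)).2 hs1)
      simp only [hF]
      rw [indicator_of_mem hy]
      simp only [hG]
      rw [rescaled_summand_eq hn hm]
      generalize ⌊(n : ℝ) / 2 + (n : ℝ) ^ (3 / 4 : ℝ) * x⌋₊ = m at *
      have hm' : (m : ℝ) ≤ n := by exact_mod_cast hm
      have hW := sq_div_le_quartic hn' (Nat.cast_nonneg m) hm'
      have hWn : 0 ≤ (n : ℝ) ^ 2 / (((m : ℝ) + 1) * (n - m + 1)) :=
        div_nonneg (sq_nonneg _) (mul_nonneg (by positivity) (by linarith))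
      have hQ := quartic_mul_exp_le ha hκ
      generalize ((m : ℝ) - n / 2) / (n : ℝ) ^ (3 / 4 : ℝ) = κ at *
      rw [Real.norm_eq_abs, abs_mul, abs_mul, abs_mul, abs_of_nonneg hWn, Real.abs_exp, mul_assoc]
      refine mul_le_mul (mul_le_mul (hC m) (hC (n - m)) (abs_nonneg _) hC0) (le_trans ?_ hQ)
        (by positivity) (by positivity)
      refine mul_le_mul hW (Real.exp_le_exp.2 ?_) (by positivity) (by positivity)
      have hD := sqrtDefect_le (μ := (m : ℝ) / n) (by positivity) ((div_le_one hn').2 hm')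
      rw [neg_mul, neg_le_neg_iff, le_div_iff₀ (sqrtDefect_pos _)]
      nlinarith [mul_nonneg ha.le (sq_nonneg κ)]
    · simp only [hF]
      rw [indicator_of_notMem hy, norm_zero]
      positivity
  have hint : Integrable (fun x : ℝ =>
      C * C * ((16 + 256 * (72 / a ^ 2)) * Real.exp (a / 6) * Real.exp (-(a / 12) * x ^ 2))) :=
    ((integrable_exp_neg_mul_sq (by positivity)).const_mul _).const_mul _
  have hlim : ∀ᵐ x ∂volume, Tendsto (fun n => F n x) atTop
      (𝓝 (4 * Real.exp (-(a / √2) * x ^ 2))) := by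
    refine Eventually.of_forall fun x => ?_
    have hyn := tendsto_half_add_div x
    have hn_pos : ∀ᶠ n : ℕ in atTop, 0 < n := eventually_gt_atTop 0
    have hy0 : ∀ᶠ n : ℕ in atTop, 0 ≤ (n : ℝ) / 2 + (n : ℝ) ^ (3 / 4 : ℝ) * x := by
      filter_upwards [hn_pos, hyn.eventually_const_lt (show (0 : ℝ) < 1 / 2 by norm_num)]
        with n hn h
      have hn' : (0 : ℝ) < n := by exact_mod_cast hn
      exact ((div_pos_iff_of_pos_right hn').1 h).le
    have hy1 : ∀ᶠ n : ℕ in atTop, (n : ℝ) / 2 + (n : ℝ) ^ (3 / 4 : ℝ) * x < n := by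
      filter_upwards [hn_pos, hyn.eventually_lt_const (show (1 / 2 : ℝ) < 1 by norm_num)]
        with n hn h
      have hn' : (0 : ℝ) < n := by exact_mod_cast hn
      exact (div_lt_one hn').1 h
    set m : ℕ → ℕ := fun n => ⌊(n : ℝ) / 2 + (n : ℝ) ^ (3 / 4 : ℝ) * x⌋₊
    have hm_le : ∀ᶠ n in atTop, m n ≤ n := by
      filter_upwards [hy1] with n h1
      exact Nat.floor_le_of_le h1.le
    have hκ : Tendsto (fun n : ℕ => ((m n : ℝ) - n / 2) / (n : ℝ) ^ (3 / 4 : ℝ)) atTop (𝓝 x) := by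
      rw [tendsto_iff_norm_sub_tendsto_zero]
      refine squeeze_zero' (Eventually.of_forall fun _ => norm_nonneg _) ?_
        (tendsto_natCast_rpow_three_quarters.const_div_atTop 1)
      filter_upwards [hn_pos, hy0] with n hn h0
      have hn' : (0 : ℝ) < n := by exact_mod_cast hn
      exact abs_floor_offset_sub_le (Real.rpow_pos_of_pos hn' _) h0
    have hμ : Tendsto (fun n : ℕ => (m n : ℝ) / n) atTop (𝓝 (1 / 2)) := by
      refine (tendsto_half_add_div x).congr_dist ?_
      refine squeeze_zero' (Eventually.of_forall fun _ => dist_nonneg) ?_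
        tendsto_one_div_atTop_nhds_zero_nat
      filter_upwards [hn_pos, hy0] with n hn h0
      have hn' : (0 : ℝ) < n := by exact_mod_cast hn
      rw [dist_comm, Real.dist_eq, ← sub_div, abs_div, abs_of_pos hn']
      gcongr
      exact abs_floor_sub_le_one h0
    have hm_top : Tendsto m atTop atTop := by
      rw [← tendsto_natCast_atTop_iff (R := ℝ)]
      refine (hμ.pos_mul_atTop (by norm_num) tendsto_natCast_atTop_atTop).congr' ?_
      filter_upwards [hn_pos] with n hn
      have : (n : ℝ) ≠ 0 := by positivity
      field_simp
    have hnm_top : Tendsto (fun n => n - m n) atTop atTop := by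
      rw [← tendsto_natCast_atTop_iff (R := ℝ)]
      refine ((hμ.const_sub 1).pos_mul_atTop (by norm_num)
        tendsto_natCast_atTop_atTop).congr' ?_
      filter_upwards [hn_pos, hm_le] with n hn hle
      have : (n : ℝ) ≠ 0 := by positivity
      rw [Nat.cast_sub hle]
      field_simp
    have hW : Tendsto (fun n : ℕ => (n : ℝ) ^ 2 / (((m n : ℝ) + 1) * (n - m n + 1)))
        atTop (𝓝 4) := by
      have h1 : Tendsto (fun n : ℕ => ((m n : ℝ) / n + 1 / n) * (1 - (m n : ℝ) / n + 1 / n))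
          atTop (𝓝 ((1 / 2 + 0) * (1 - 1 / 2 + 0))) :=
        (hμ.add tendsto_one_div_atTop_nhds_zero_nat).mul
          ((hμ.const_sub 1).add tendsto_one_div_atTop_nhds_zero_nat)
      have h2 := h1.inv₀ (by norm_num)
      rw [show (((1 / 2 + 0) * (1 - 1 / 2 + 0) : ℝ))⁻¹ = 4 by norm_num] at h2
      refine h2.congr' ?_
      filter_upwards [hn_pos, hm_le] with n hn hle
      have hn' : (n : ℝ) ≠ 0 := by positivity
      rw [← add_div, one_sub_div hn', ← add_div, div_mul_div_comm, inv_div, sq]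
    have hE : Tendsto (fun n : ℕ => Real.exp (-(4 * a *
        (((m n : ℝ) - n / 2) / (n : ℝ) ^ (3 / 4 : ℝ)) ^ 2 / sqrtDefect (m n / n))))
        atTop (𝓝 (Real.exp (-(a / √2) * x ^ 2))) := by
      have h1 := (((hκ.pow 2).const_mul (4 * a)).div
        ((continuous_sqrtDefect.tendsto (1 / 2)).comp hμ) (sqrtDefect_pos _).ne').neg
      rw [sqrtDefect_half, show -(4 * a * x ^ 2 / (4 * √2)) = -(a / √2) * x ^ 2 by
        field_simp] at h1
      exact (Real.continuous_exp.tendsto _).comp h1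
    have hprod := (((hr.comp hm_top).mul (hr.comp hnm_top)).mul hW).mul hE
    rw [one_mul, one_mul] at hprod
    refine hprod.congr' ?_
    filter_upwards [hn_pos, hm_le, hy0, hy1] with n hn hle h0 h1
    have hy : (n : ℝ) / 2 + (n : ℝ) ^ (3 / 4 : ℝ) * x ∈ Ico (0 : ℝ) (n + 1 : ℕ) :=
      ⟨h0, by push_cast; linarith⟩
    simp only [hF]
    rw [indicator_of_mem hy]
    exact (rescaled_summand_eq hn hle).symm
  have hmain := tendsto_integral_filter_of_dominated_convergence _
    (Eventually.of_forall hFmeas) hbound hint hlim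
  rw [integral_const_mul, integral_gaussian] at hmain
  refine hmain.congr' ?_
  filter_upwards [eventually_gt_atTop 0] with n hn
  have hn' : (0 : ℝ) < n := by exact_mod_cast hn
  rw [← sum_range_eq_mul_integral (G n) (n + 1) ((n : ℝ) / 2) (Real.rpow_pos_of_pos hn' _),
    Finset.sum_mul, Finset.sum_div]

lemma c_pos : 0 < c := by
  unfold c
  positivity

lemma sqrt_pi_div_c_div_sqrt_two :
    √(Real.pi / (c / √2)) = (3 : ℝ) ^ (1 / 4 : ℝ) := by
  have hc : c * √6 = 2 * Real.pi := by
    unfold c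
    rw [Real.sqrt_div (by positivity), Real.sqrt_sq Real.pi_pos.le]
    field_simp
  have h6 : √6 = √2 * √3 := by
    rw [← Real.sqrt_mul (by norm_num)]
    norm_num
  have h : Real.pi / (c / √2) = √3 := by
    have := c_pos.ne'
    rw [div_div_eq_mul_div, div_eq_iff this]
    rw [h6] at hc
    have h2 := Real.mul_self_sqrt (show (0 : ℝ) ≤ 2 by norm_num)
    linear_combination (-√2 / 2) * hc + c * √3 / 2 * h2
  rw [h, Real.sqrt_eq_rpow, Real.sqrt_eq_rpow, ← Real.rpow_mul (by norm_num)]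
  norm_num

/-- If `p n ∼ e^{c√n}/(bn)` as `n → ∞`, then
`t n ∼ (e^{c√(2n)}/n^{5/4}) · (2² 3^{1/4}/b²)` as `n → ∞`. -/
theorem t_asymptotic (b : ℝ)
    (hb : Tendsto (fun n : ℕ => (p n : ℝ) * (b * n) / Real.exp (c * Real.sqrt n))
      atTop (nhds 1)) :
    Tendsto (fun n : ℕ =>
        (t n : ℝ) * (b ^ 2 * (n : ℝ) ^ (5 / 4 : ℝ)) /
          (4 * (3 : ℝ) ^ (1 / 4 : ℝ) * Real.exp (c * Real.sqrt (2 * n))))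
      atTop (nhds 1) := by
  have hu : Tendsto (fun n : ℕ => (b * p n) * n / Real.exp (c * √n)) atTop (𝓝 1) :=
    hb.congr fun n => by ring
  have h := (tendsto_convolution_exp_sqrt c_pos hu).div_const (4 * (3 : ℝ) ^ (1 / 4 : ℝ))
  rw [sqrt_pi_div_c_div_sqrt_two, div_self (by positivity)] at h
  refine h.congr fun n => ?_
  have ht : (t n : ℝ) * b ^ 2 = ∑ m ∈ Finset.range (n + 1), b * p m * (b * p (n - m)) := by
    unfold t
    push_cast
    rw [Finset.sum_mul]
    exact Finset.sum_congr rfl fun m _ => by ring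
  rw [← ht, div_div, mul_assoc, mul_comm (Real.exp _)]
end

section
/- Let c = 2√(π²/6). If b is a real number such that p(n) ∼ e^{c√n}/(b·n) as n → ∞ (i.e. p(n)·b·n / e^{c√n} → 1), then necessarily b = 4√3. -/
open Filter

open PowerSeries in
/-- Evaluation of real power series at `q` is multiplicative, where both series converge. -/
lemma hasSum_coeff_mul {A B : PowerSeries ℝ} {q α β : ℝ}
    (hA : HasSum (fun n => coeff n A * q ^ n) α) (hB : HasSum (fun n => coeff n B * q ^ n) β) :
    HasSum (fun n => coeff n (A * B) * q ^ n) (α * β) := by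
  have hA' : Summable fun n => ‖coeff n A * q ^ n‖ := hA.summable.norm
  have hB' : Summable fun n => ‖coeff n B * q ^ n‖ := hB.summable.norm
  have key (n : ℕ) : coeff n (A * B) * q ^ n =
      ∑ kl ∈ Finset.HasAntidiagonal.antidiagonal n, (coeff kl.1 A * q ^ kl.1) * (coeff kl.2 B * q ^ kl.2) := by
    rw [coeff_mul, Finset.sum_mul]
    refine Finset.sum_congr rfl fun kl hkl => ?_
    rw [← Finset.HasAntidiagonal.mem_antidiagonal.mp hkl, pow_add]
    ring
  simp_rw [key]
  rw [← hA.tsum_eq, ← hB.tsum_eq,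
    tsum_mul_tsum_eq_tsum_sum_antidiagonal_of_summable_norm hA' hB']
  exact (summable_norm_sum_mul_antidiagonal_of_summable_norm hA' hB').of_norm.hasSum

open PowerSeries in
/-- The power series `∑ X ^ (d j)`. -/
noncomputable def multiplesSeries (d : ℕ) : PowerSeries ℝ :=
  PowerSeries.mk fun n => if d ∣ n then 1 else 0

open PowerSeries PowerSeries.WithPiTopology in
lemma one_add_tsum_eq_multiplesSeries (i : ℕ) :
    (1 + ∑' j, (1 : ℝ) • X ^ ((i + 1) * (j + 1)) : PowerSeries ℝ) = multiplesSeries (i + 1) := by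
  have hs := Nat.Partition.summable_genFun_term (fun _ _ => (1 : ℝ)) i
  ext n
  rw [map_add, hs.map_tsum _ (continuous_coeff _ _), multiplesSeries, coeff_mk]
  simp only [one_smul, coeff_X_pow, coeff_one]
  by_cases h : (i + 1) ∣ n
  · obtain ⟨k, rfl⟩ := h
    rcases k with _ | k
    · simp
    · rw [tsum_eq_single k]
      · simp
      · intro b hb
        have : k ≠ b := hb.symm
        simp [this]
  · have h0 : n ≠ 0 := by rintro rfl; simp at h
    have h1 (j : ℕ) : n ≠ (i + 1) * (j + 1) := by rintro rfl; simp at h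
    simp [h, h0, h1]

open PowerSeries in
lemma hasSum_multiplesSeries {q : ℝ} (hq : 0 ≤ q) (hq1 : q < 1) (i : ℕ) :
    HasSum (fun n => coeff n (multiplesSeries (i + 1)) * q ^ n) (1 - q ^ (i + 1))⁻¹ := by
  have hinj : Function.Injective fun j : ℕ => (i + 1) * j :=
    fun a b h => Nat.eq_of_mul_eq_mul_left i.succ_pos h
  rw [← hinj.hasSum_iff]
  · have := hasSum_geometric_of_lt_one (pow_nonneg hq (i + 1))
      (pow_lt_one₀ hq hq1 i.succ_ne_zero)
    refine this.congr_fun ?_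
    intro j
    simp [multiplesSeries, pow_mul]
  · intro n hn
    have : ¬ (i + 1) ∣ n := fun ⟨k, hk⟩ => hn ⟨k, hk.symm⟩
    simp [multiplesSeries, this]

open PowerSeries in
lemma coeff_prod_multiplesSeries_nonneg (m n : ℕ) :
    0 ≤ coeff n (∏ i ∈ Finset.range m, multiplesSeries (i + 1)) := by
  induction m generalizing n with
  | zero => simp only [Finset.range_zero, Finset.prod_empty, coeff_one]; positivity
  | succ m ih =>
    rw [Finset.prod_range_succ, coeff_mul]
    refine Finset.sum_nonneg fun kl _ => mul_nonneg (ih _) ?_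
    rw [multiplesSeries, coeff_mk]
    positivity

open PowerSeries in
lemma monotone_coeff_prod_multiplesSeries (n : ℕ) :
    Monotone fun m => coeff n (∏ i ∈ Finset.range m, multiplesSeries (i + 1)) := by
  refine monotone_nat_of_le_succ fun m => ?_
  rw [Finset.prod_range_succ, coeff_mul]
  refine le_trans (le_of_eq ?_) (Finset.single_le_sum (f := fun kl : ℕ × ℕ =>
    coeff kl.1 (∏ i ∈ Finset.range m, multiplesSeries (i + 1)) *
      coeff kl.2 (multiplesSeries (m + 1))) (fun kl _ => mul_nonneg
      (coeff_prod_multiplesSeries_nonneg m _) ?_) 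
      (Finset.HasAntidiagonal.mem_antidiagonal (a := (n, 0)) |>.mpr (add_zero n)))
  · simp [multiplesSeries]
  · rw [multiplesSeries, coeff_mk]
    positivity

open PowerSeries in
lemma hasSum_prod_multiplesSeries {q : ℝ} (hq : 0 ≤ q) (hq1 : q < 1) (m : ℕ) :
    HasSum (fun n => coeff n (∏ i ∈ Finset.range m, multiplesSeries (i + 1)) * q ^ n)
      (∏ i ∈ Finset.range m, (1 - q ^ (i + 1))⁻¹) := by
  induction m with
  | zero =>
    simp only [Finset.range_zero, Finset.prod_empty]
    convert hasSum_ite_eq (0 : ℕ) (1 : ℝ) using 2 with n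
    rw [coeff_one]
    split_ifs with h <;> simp [h]
  | succ m ih =>
    simp only [Finset.prod_range_succ]
    exact hasSum_coeff_mul ih (hasSum_multiplesSeries hq hq1 m)

open PowerSeries PowerSeries.WithPiTopology in
lemma tendsto_coeff_prod_multiplesSeries (n : ℕ) :
    Tendsto (fun m => coeff n (∏ i ∈ Finset.range m, multiplesSeries (i + 1))) atTop
      (nhds (p n : ℝ)) := by
  have h := (Nat.Partition.hasProd_genFun (fun _ _ => (1 : ℝ))).tendsto_prod_nat
  simp only [one_add_tsum_eq_multiplesSeries] at h
  have h2 := ((continuous_coeff ℝ n).tendsto _).comp h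
  simpa [Finsupp.prod, p, Function.comp_def] using h2

/-- Euler's product for the partition generating function. -/
lemma hasSum_partition {q P : ℝ} (hq : 0 ≤ q) (hq1 : q < 1)
    (hP : Tendsto (fun m => ∏ i ∈ Finset.range m, (1 - q ^ (i + 1))) atTop (nhds P))
    (hP0 : P ≠ 0) : HasSum (fun n => (p n : ℝ) * q ^ n) P⁻¹ := by
  set u := fun m n => PowerSeries.coeff n (∏ i ∈ Finset.range m, multiplesSeries (i + 1)) with hu
  have hle (m n : ℕ) : u m n ≤ p n :=
    (monotone_coeff_prod_multiplesSeries n).ge_of_tendsto (tendsto_coeff_prod_multiplesSeries n) m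
  have hlim : Tendsto (fun m => ∑' n, u m n * q ^ n) atTop (nhds P⁻¹) := by
    simp_rw [hu, fun m => (hasSum_prod_multiplesSeries hq hq1 m).tsum_eq, Finset.prod_inv_distrib]
    exact hP.inv₀ hP0
  have hu0 (m n : ℕ) : 0 ≤ u m n * q ^ n :=
    mul_nonneg (coeff_prod_multiplesSeries_nonneg m n) (pow_nonneg hq n)
  have hsum : Summable fun n => (p n : ℝ) * q ^ n := by
    refine summable_of_sum_range_le (c := P⁻¹) (fun n => by positivity) fun N => ?_
    have h1 : Tendsto (fun m => ∑ n ∈ Finset.range N, u m n * q ^ n) atTop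
        (nhds (∑ n ∈ Finset.range N, (p n : ℝ) * q ^ n)) :=
      tendsto_finsetSum _ fun n _ => (tendsto_coeff_prod_multiplesSeries n).mul_const _
    exact le_of_tendsto_of_tendsto' h1 hlim fun m =>
      (hasSum_prod_multiplesSeries hq hq1 m).summable.sum_le_tsum _ fun n _ => hu0 m n
  have hlim' : Tendsto (fun m => ∑' n, u m n * q ^ n) atTop (nhds (∑' n, (p n : ℝ) * q ^ n)) := by
    refine tendsto_tsum_of_dominated_convergence hsum
      (fun n => (tendsto_coeff_prod_multiplesSeries n).mul_const _)
      (Eventually.of_forall fun m n => ?_)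
    rw [Real.norm_of_nonneg (hu0 m n)]
    exact mul_le_mul_of_nonneg_right (hle m n) (pow_nonneg hq n)
  rw [← tendsto_nhds_unique hlim' hlim]
  exact hsum.hasSum

/-- Euler's function `∏ (1 - q ^ (n + 1))` at `q = exp (-x)`. -/
noncomputable def eulerProd (x : ℝ) : ℝ := ∏' n : ℕ, (1 - Real.exp (-x) ^ (n + 1))

lemma summable_exp_neg_pow_succ {x : ℝ} (hx : 0 < x) :
    Summable fun n : ℕ => Real.exp (-x) ^ (n + 1) :=
  (summable_nat_add_iff 1).mpr (summable_geometric_of_lt_one (Real.exp_pos _).le (by simpa))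

lemma multipliable_eulerProd {x : ℝ} (hx : 0 < x) :
    Multipliable fun n : ℕ => 1 - Real.exp (-x) ^ (n + 1) := by
  simpa [sub_eq_add_neg] using
    Real.multipliable_one_add_of_summable (summable_exp_neg_pow_succ hx).neg

lemma eulerProd_ne_zero {x : ℝ} (hx : 0 < x) : eulerProd x ≠ 0 := by
  refine tprod_one_add_ne_zero_of_summable (f := fun n : ℕ => -Real.exp (-x) ^ (n + 1)) ?_ ?_
  · intro n
    have := pow_lt_one₀ (Real.exp_pos (-x)).le (by simpa) n.succ_ne_zero
    simp only [Nat.succ_eq_add_one] at this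
    linarith
  · simpa using summable_exp_neg_pow_succ hx

lemma tendsto_eulerProd_atTop : Tendsto eulerProd atTop (nhds 1) := by
  have h := tendsto_tprod_one_add_of_dominated_convergence (𝓕 := atTop) (g := fun _ : ℕ => (0 : ℝ))
    (f := fun (x : ℝ) (n : ℕ) => -Real.exp (-x) ^ (n + 1))
    (bound := fun n => Real.exp (-1) ^ (n + 1)) (summable_exp_neg_pow_succ one_pos) ?_ ?_
  · simp only [add_zero, tprod_one, ← sub_eq_add_neg] at h
    exact h
  · intro n
    simpa using ((Real.tendsto_exp_atBot.comp tendsto_neg_atTop_atBot).pow (n + 1)).neg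
  · filter_upwards [eventually_ge_atTop 1] with x hx n
    rw [norm_neg, Real.norm_of_nonneg (by positivity)]
    gcongr

open Complex in
lemma eta_I_mul {y : ℝ} (hy : 0 < y) : ModularForm.eta (I * y) =
    ((Real.exp (-(2 * Real.pi * y) / 24) * eulerProd (2 * Real.pi * y) : ℝ) : ℂ) := by
  have hm := (multipliable_eulerProd (x := 2 * Real.pi * y) (by positivity)).map_tprod
    ofRealHom continuous_ofReal
  have hI : 2 * (Real.pi : ℂ) * I * (I * y) = -(2 * Real.pi * y) := by
    linear_combination (2 * (Real.pi : ℂ) * y) * I_mul_I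
  simp only [ofRealHom_eq_coe] at hm
  rw [ModularForm.eta, eulerProd, ofReal_mul, hm]
  simp only [ModularForm.eta_q_eq_pow, Function.Periodic.qParam, hI]
  push_cast
  rfl

open Complex in
/-- The modular transformation of Euler's function. -/
lemma eulerProd_inversion {y : ℝ} (hy : 0 < y) :
    Real.exp (-(2 * Real.pi * y⁻¹) / 24) * eulerProd (2 * Real.pi * y⁻¹) =
      √y * (Real.exp (-(2 * Real.pi * y) / 24) * eulerProd (2 * Real.pi * y)) := by
  have h := ModularForm.eta_comp_eq_csqrt_I_inv
    (show I * y ∈ UpperHalfPlane.upperHalfPlaneSet by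
      simpa [UpperHalfPlane.upperHalfPlaneSet] using hy)
  have hy' : (y : ℂ) ≠ 0 := ofReal_ne_zero.mpr hy.ne'
  have h1 : -1 / (I * (y : ℂ)) = I * (y⁻¹ : ℝ) := by
    push_cast
    field_simp
    simp
  have h2 : sqrt (I * y) = sqrt I * (√y : ℝ) := by
    rw [sqrt_eq_exp (mul_ne_zero I_ne_zero hy'), sqrt_eq_exp I_ne_zero, mul_comm I,
      log_ofReal_mul hy I_ne_zero, Real.sqrt_eq_rpow, Real.rpow_def_of_pos hy, ofReal_exp,
      ← Complex.exp_add]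
    push_cast
    ring_nf
  have h3 : sqrt I ≠ 0 := by simp [sqrt_eq_exp I_ne_zero]
  simp only [Function.comp_apply, Pi.smul_apply, Pi.mul_apply, smul_eq_mul, h1, h2] at h
  rw [eta_I_mul hy, eta_I_mul (inv_pos.mpr hy), mul_assoc (sqrt I), inv_mul_cancel_left₀ h3] at h
  exact_mod_cast h

open MeasureTheory in
lemma integrable_exp_neg_mul_abs {α : ℝ} (hα : 0 < α) :
    Integrable fun s : ℝ => Real.exp (-(α * |s|)) := by
  have hi : Integrable fun s : ℝ => (1 + (α / 2 * s) ^ 2)⁻¹ :=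
    integrable_inv_one_add_sq.comp_mul_left' (half_pos hα).ne'
  refine hi.mono' (by fun_prop) (Eventually.of_forall fun s => ?_)
  rw [Real.norm_of_nonneg (Real.exp_pos _).le, Real.exp_neg]
  have h0 : 0 ≤ α * |s| := by positivity
  gcongr
  have h1 := Real.quadratic_le_exp_of_nonneg h0
  have h2 : (α / 2 * s) ^ 2 = (α * |s|) ^ 2 / 4 := by rw [mul_pow, mul_pow, sq_abs]; ring
  nlinarith

open MeasureTheory in
/-- A series as the integral of the corresponding step function. -/
lemma hasSum_of_integrable_comp_natCeil {g : ℕ → ℝ} (h0 : g 0 = 0)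
    (hi : Integrable fun y : ℝ => g ⌈y⌉₊) : HasSum g (∫ y : ℝ, g ⌈y⌉₊) := by
  have hU : (⋃ n : ℕ, Set.Ioc (n : ℝ) (n + 1)) = Set.Ioi 0 := by
    ext y
    simp only [Set.mem_iUnion, Set.mem_Ioc, Set.mem_Ioi]
    constructor
    · rintro ⟨n, hn, -⟩
      exact n.cast_nonneg.trans_lt hn
    · intro hy
      have hc : 0 < ⌈y⌉₊ := Nat.ceil_pos.mpr hy
      obtain ⟨m, hm⟩ := Nat.exists_eq_add_one_of_ne_zero hc.ne'
      have h1 := Nat.ceil_lt_add_one hy.le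
      have h2 := Nat.le_ceil y
      rw [hm] at h1 h2
      push_cast at h1 h2
      exact ⟨m, by linarith, h2⟩
  have hd : Pairwise (Function.onFun Disjoint fun n : ℕ => Set.Ioc (n : ℝ) (n + 1)) := by
    intro m n hmn
    refine Set.disjoint_left.mpr fun y hm hn => hmn ?_
    have h1 : (m : ℝ) < n + 1 := hm.1.trans_le hn.2
    have h2 : (n : ℝ) < m + 1 := hn.1.trans_le hm.2
    norm_cast at h1 h2
    omega
  have hs := hasSum_integral_iUnion (fun n : ℕ => measurableSet_Ioc) hd
    (hi.integrableOn (s := ⋃ n : ℕ, Set.Ioc (n : ℝ) (n + 1)))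
  rw [hU, setIntegral_eq_integral_of_forall_compl_eq_zero] at hs
  · have hc (n : ℕ) : ∫ y in Set.Ioc (n : ℝ) (n + 1), g ⌈y⌉₊ = g (n + 1) := by
      rw [setIntegral_congr_fun (g := fun _ => g (n + 1)) measurableSet_Ioc]
      · simp
      · intro y hy
        have : ⌈y⌉₊ = n + 1 := by
          rw [Nat.ceil_eq_iff (by simp)]
          exact ⟨by simpa using hy.1, by simpa using hy.2⟩
        simp only [this]
    simp only [hc] at hs
    rw [hasSum_nat_add_iff' 1 |>.symm]
    simpa [h0] using hs
  · intro y hy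
    rw [Nat.ceil_eq_zero.mpr (by simpa using hy), h0]

/-- The summand `exp (c √n - x n) / n`, normalised by its exponential maximum, for
`c = 2 a` and `x = a / k ^ 2`. -/
noncomputable def laplaceWeight (a k n : ℝ) : ℝ :=
  Real.exp (-(a / k ^ 2 * (√n - k ^ 2) ^ 2)) / n

lemma abs_div_two_sub_one_le {k n : ℝ} (hk : 1 ≤ k) (hn : 0 ≤ n) :
    |(n - k ^ 4) / k ^ 3| / 2 - 1 ≤ (√n - k ^ 2) ^ 2 / k ^ 2 := by
  have hk0 : 0 < k := by linarith
  obtain ⟨r, hr0, hr⟩ : ∃ r, 0 ≤ r ∧ √n = k ^ 2 * r := ⟨√n / k ^ 2, by positivity, by field_simp⟩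
  have hn' : n = (k ^ 2 * r) ^ 2 := by rw [← hr, Real.sq_sqrt hn]
  have h1 : (n - k ^ 4) / k ^ 3 = k * (r - 1) * (r + 1) := by rw [hn']; field_simp; ring
  have h2 : (√n - k ^ 2) ^ 2 / k ^ 2 = (k * (r - 1)) ^ 2 := by rw [hr]; field_simp
  rw [h1, h2, abs_mul, abs_of_nonneg (by linarith : 0 ≤ r + 1)]
  rcases le_or_gt r 3 with h3 | h3
  · rw [← sq_abs]
    nlinarith [sq_nonneg (|k * (r - 1)| - 1), abs_nonneg (k * (r - 1))]
  · have h4 : 0 < r - 1 := by linarith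
    have h5 : 2 ≤ k * (r - 1) := by nlinarith
    rw [abs_of_pos (by positivity)]
    have h6 : (r + 1) / 2 ≤ k * (r - 1) := by nlinarith
    nlinarith [mul_le_mul_of_nonneg_left h6 (by linarith : 0 ≤ k * (r - 1))]

lemma laplaceWeight_le {a k n : ℝ} (ha : 0 < a) (hk : 1 ≤ k) (hn : 1 ≤ n) :
    k ^ 4 * laplaceWeight a k n ≤
      (4 + 128 / a ^ 2) * Real.exp a * Real.exp (-(a / 4 * |(n - k ^ 4) / k ^ 3|)) := by
  have hk0 : 0 < k := by linarith
  have hn0 : 0 < n := by linarith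
  set w := |(n - k ^ 4) / k ^ 3|
  have hw0 : 0 ≤ w := abs_nonneg _
  have hQ : w / 2 - 1 ≤ (√n - k ^ 2) ^ 2 / k ^ 2 := abs_div_two_sub_one_le hk hn0.le
  set Q := (√n - k ^ 2) ^ 2 / k ^ 2 with hQdef
  have hlw : k ^ 4 * laplaceWeight a k n = k ^ 4 / n * Real.exp (-(a * Q)) := by
    rw [laplaceWeight, hQdef]
    have : a / k ^ 2 * (√n - k ^ 2) ^ 2 = a * ((√n - k ^ 2) ^ 2 / k ^ 2) := by ring
    rw [this]
    ring
  rw [hlw]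
  rcases le_or_gt (k ^ 4 / 4) n with h | h
  · calc k ^ 4 / n * Real.exp (-(a * Q)) ≤ 4 * Real.exp (a + -(a / 4 * w)) := by
          gcongr
          · rw [div_le_iff₀ hn0]; linarith
          · nlinarith [mul_le_mul_of_nonneg_left hQ ha.le, mul_nonneg ha.le hw0]
      _ ≤ (4 + 128 / a ^ 2) * Real.exp (a + -(a / 4 * w)) := by
          gcongr
          have : 0 < 128 / a ^ 2 := by positivity
          linarith
      _ = _ := by rw [Real.exp_add]; ring
  · have h1 : √n ≤ k ^ 2 / 2 := by
      rw [Real.sqrt_le_left (by positivity)]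
      nlinarith
    have h2 : k ^ 2 / 4 ≤ Q := by
      rw [hQdef, le_div_iff₀ (by positivity)]
      nlinarith
    have h3 : k ^ 4 * Real.exp (-(a * Q / 2)) ≤ 128 / a ^ 2 := by
      have h4 := Real.quadratic_le_exp_of_nonneg (x := a * k ^ 2 / 8) (by positivity)
      have h5 : Real.exp (a * k ^ 2 / 8) ≤ Real.exp (a * Q / 2) :=
        Real.exp_le_exp.mpr (by nlinarith [mul_le_mul_of_nonneg_left h2 ha.le])
      have h6 : 0 < a * k ^ 2 / 8 := by positivity
      rw [Real.exp_neg, ← div_eq_mul_inv, div_le_div_iff₀ (Real.exp_pos _) (by positivity)]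
      nlinarith
    calc k ^ 4 / n * Real.exp (-(a * Q)) ≤ k ^ 4 * Real.exp (-(a * Q)) := by
          gcongr
          exact div_le_self (by positivity) hn
      _ = k ^ 4 * Real.exp (-(a * Q / 2)) * Real.exp (-(a * Q / 2)) := by
          rw [mul_assoc, ← Real.exp_add]; ring_nf
      _ ≤ (4 + 128 / a ^ 2) * Real.exp (a + -(a / 4 * w)) := by
          gcongr
          · linarith
          · nlinarith [mul_le_mul_of_nonneg_left hQ ha.le]
      _ = _ := by rw [Real.exp_add]; ring

lemma abs_natCeil_sub_div_sub_le {k s : ℝ} (hk : 0 < k) (hy : 0 < k ^ 4 + k ^ 3 * s) :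
    |((⌈k ^ 4 + k ^ 3 * s⌉₊ : ℝ) - k ^ 4) / k ^ 3 - s| ≤ (k ^ 3)⁻¹ := by
  have h1 := Nat.ceil_lt_add_one hy.le
  have h2 := Nat.le_ceil (k ^ 4 + k ^ 3 * s)
  have h3 : ((⌈k ^ 4 + k ^ 3 * s⌉₊ : ℝ) - k ^ 4) / k ^ 3 - s =
      ((⌈k ^ 4 + k ^ 3 * s⌉₊ : ℝ) - (k ^ 4 + k ^ 3 * s)) / k ^ 3 := by
    field_simp
    ring
  rw [h3, abs_of_nonneg (div_nonneg (by linarith) (by positivity)), ← one_div]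
  gcongr
  linarith

lemma laplaceWeight_natCeil_le {a : ℝ} (ha : 0 < a) (k : ℕ) (s : ℝ) :
    (k : ℝ) ^ 4 * laplaceWeight a k ⌈(k : ℝ) ^ 4 + (k : ℝ) ^ 3 * s⌉₊ ≤
      (4 + 128 / a ^ 2) * Real.exp a * Real.exp (a / 4) * Real.exp (-(a / 4 * |s|)) := by
  rcases Nat.eq_zero_or_pos k with rfl | hk
  · simp only [Nat.cast_zero, ne_eq, OfNat.ofNat_ne_zero, not_false_eq_true, zero_pow, zero_mul]
    positivity
  rcases le_or_gt ((k : ℝ) ^ 4 + (k : ℝ) ^ 3 * s) 0 with hy | hy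
  · rw [Nat.ceil_eq_zero.mpr hy]
    simp only [laplaceWeight, Nat.cast_zero, div_zero, mul_zero]
    positivity
  have hk1 : (1 : ℝ) ≤ k := by exact_mod_cast hk
  have hN : (1 : ℝ) ≤ ⌈(k : ℝ) ^ 4 + (k : ℝ) ^ 3 * s⌉₊ := by exact_mod_cast Nat.ceil_pos.mpr hy
  refine (laplaceWeight_le ha hk1 hN).trans ?_
  rw [mul_assoc _ (Real.exp (a / 4)), ← Real.exp_add]
  have h1 := abs_natCeil_sub_div_sub_le (by linarith) hy
  have h2 : ((k : ℝ) ^ 3)⁻¹ ≤ 1 := inv_le_one_of_one_le₀ (one_le_pow₀ hk1)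
  have h3 := abs_sub_abs_le_abs_sub s
    (((⌈(k : ℝ) ^ 4 + (k : ℝ) ^ 3 * s⌉₊ : ℝ) - (k : ℝ) ^ 4) / (k : ℝ) ^ 3)
  rw [abs_sub_comm] at h3
  gcongr
  nlinarith

lemma tendsto_natCeil_sub_div (s : ℝ) :
    Tendsto (fun k : ℕ => ((⌈(k : ℝ) ^ 4 + (k : ℝ) ^ 3 * s⌉₊ : ℝ) - (k : ℝ) ^ 4) / (k : ℝ) ^ 3)
      atTop (nhds s) := by
  rw [tendsto_iff_norm_sub_tendsto_zero]
  have hinv : Tendsto (fun k : ℕ => ((k : ℝ) ^ 3)⁻¹) atTop (nhds 0) :=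
    tendsto_inv_atTop_zero.comp
      ((tendsto_pow_atTop three_ne_zero).comp tendsto_natCast_atTop_atTop)
  refine squeeze_zero' (Eventually.of_forall fun k => norm_nonneg _) ?_ hinv
  filter_upwards [tendsto_natCast_atTop_atTop.eventually_gt_atTop (|s| + 1)] with k hk
  have hs := neg_abs_le s
  have hk0 : (0 : ℝ) < k := by linarith [abs_nonneg s]
  refine abs_natCeil_sub_div_sub_le hk0 ?_
  have : (k : ℝ) ^ 4 + (k : ℝ) ^ 3 * s = (k : ℝ) ^ 3 * (k + s) := by ring
  rw [this]
  exact mul_pos (by positivity) (by linarith)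

lemma tendsto_natCeil_atTop (s : ℝ) :
    Tendsto (fun k : ℕ => ⌈(k : ℝ) ^ 4 + (k : ℝ) ^ 3 * s⌉₊) atTop atTop := by
  refine tendsto_nat_ceil_atTop.comp ?_
  have h : Tendsto (fun x : ℝ => x ^ 3 * (x + s)) atTop atTop :=
    (tendsto_pow_atTop three_ne_zero).atTop_mul_atTop₀ (tendsto_atTop_add_const_right _ _ tendsto_id)
  refine (h.comp tendsto_natCast_atTop_atTop).congr fun k => ?_
  simp only [Function.comp_apply]
  ring

lemma laplaceWeight_eq {a k n w : ℝ} (hk : 0 < k) (hn : 0 < n) (hw : (n - k ^ 4) / k ^ 3 = w) :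
    k ^ 4 * laplaceWeight a k n =
      Real.exp (-(a * (w / (√(1 + w / k) + 1)) ^ 2)) / (1 + w / k) := by
  have h1 : n = k ^ 4 * (1 + w / k) := by rw [← hw]; field_simp; ring
  have h2 : 0 < 1 + w / k := by
    rw [h1] at hn
    exact pos_of_mul_pos_right hn (by positivity)
  have h3 : √n = k ^ 2 * √(1 + w / k) := by
    rw [h1, Real.sqrt_mul (by positivity), show k ^ 4 = (k ^ 2) ^ 2 by ring,
      Real.sqrt_sq (by positivity)]
  have h4 : a / k ^ 2 * (√n - k ^ 2) ^ 2 = a * (w / (√(1 + w / k) + 1)) ^ 2 := by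
    have h5 : w = k * ((√(1 + w / k) - 1) * (√(1 + w / k) + 1)) := by
      have h6 := Real.sq_sqrt h2.le
      have h7 : (√(1 + w / k) - 1) * (√(1 + w / k) + 1) = w / k := by linear_combination h6
      rw [h7]
      field_simp
    have h8 : w / (√(1 + w / k) + 1) = k * (√(1 + w / k) - 1) := by
      rw [div_eq_iff (by positivity)]
      linear_combination h5
    rw [h8, h3]
    field_simp
  rw [laplaceWeight, h4, ← mul_div_assoc, div_eq_div_iff hn.ne' h2.ne']
  linear_combination (-Real.exp (-(a * (w / (√(1 + w / k) + 1)) ^ 2))) * h1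

lemma tendsto_laplaceWeight_natCeil (a s : ℝ) :
    Tendsto (fun k : ℕ => (k : ℝ) ^ 4 * laplaceWeight a k ⌈(k : ℝ) ^ 4 + (k : ℝ) ^ 3 * s⌉₊)
      atTop (nhds (Real.exp (-(a / 4) * s ^ 2))) := by
  have hw := tendsto_natCeil_sub_div s
  set w := fun k : ℕ => ((⌈(k : ℝ) ^ 4 + (k : ℝ) ^ 3 * s⌉₊ : ℝ) - (k : ℝ) ^ 4) / (k : ℝ) ^ 3
  have h1 : Tendsto (fun k : ℕ => 1 + w k / k) atTop (nhds 1) := by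
    simpa using (hw.div_atTop tendsto_natCast_atTop_atTop).const_add 1
  have h2 : Tendsto (fun k : ℕ => √(1 + w k / k) + 1) atTop (nhds 2) := by
    have := (h1.sqrt).add_const 1
    rwa [Real.sqrt_one, one_add_one_eq_two] at this
  have h3 := ((((hw.div h2 two_ne_zero).pow 2).const_mul a).neg.rexp).div h1 one_ne_zero
  have h4 : Real.exp (-(a * (s / 2) ^ 2)) / 1 = Real.exp (-(a / 4) * s ^ 2) := by
    rw [div_one]
    ring_nf
  rw [h4] at h3
  refine h3.congr' ?_
  filter_upwards [eventually_gt_atTop 0, (tendsto_natCeil_atTop s).eventually_gt_atTop 0]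
    with k hk hN
  exact (laplaceWeight_eq (Nat.cast_pos.mpr hk) (Nat.cast_pos.mpr hN) rfl).symm

open MeasureTheory in
/-- Laplace's method for `∑ h n exp (c √n - x n) / n` along `x = a / k ^ 2`, `c = 2 a`. -/
lemma tendsto_mul_tsum_laplaceWeight {a H : ℝ} (ha : 0 < a) {h : ℕ → ℝ}
    (hH : ∀ n, |h n| ≤ H) (hlim : Tendsto h atTop (nhds 1)) :
    Tendsto (fun k : ℕ => (k : ℝ) * ∑' n : ℕ, h n * laplaceWeight a k n) atTop
      (nhds (√(Real.pi / (a / 4)))) := by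
  set N := fun (k : ℕ) (s : ℝ) => ⌈(k : ℝ) ^ 4 + (k : ℝ) ^ 3 * s⌉₊ with hN
  set G := fun (k : ℕ) (s : ℝ) => (k : ℝ) ^ 4 * (h (N k s) * laplaceWeight a k (N k s)) with hG
  set bound := fun s : ℝ => H * ((4 + 128 / a ^ 2) * Real.exp a * Real.exp (a / 4) *
    Real.exp (-(a / 4 * |s|)))
  have hmeas (k : ℕ) : AEStronglyMeasurable (G k) volume := by
    have hNm : Measurable (N k) := Nat.measurable_ceil.comp (by fun_prop)
    have : Measurable fun n : ℕ => (k : ℝ) ^ 4 * (h n * laplaceWeight a k n) :=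
      measurable_from_top
    exact (this.comp hNm).aestronglyMeasurable
  have hbi : Integrable bound :=
    ((integrable_exp_neg_mul_abs (by positivity : 0 < a / 4)).const_mul _).const_mul _
  have hle (k : ℕ) (s : ℝ) : ‖G k s‖ ≤ bound s := by
    have h0 : 0 ≤ (k : ℝ) ^ 4 * laplaceWeight a k (N k s) := by
      unfold laplaceWeight
      positivity
    simp only [hG]
    rw [mul_left_comm, norm_mul, Real.norm_of_nonneg h0]
    exact mul_le_mul (hH _) (laplaceWeight_natCeil_le ha k s) h0 ((abs_nonneg _).trans (hH 0))
  have hpt (s : ℝ) : Tendsto (fun k => G k s) atTop (nhds (Real.exp (-(a / 4) * s ^ 2))) := by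
    have := (hlim.comp (tendsto_natCeil_atTop s)).mul (tendsto_laplaceWeight_natCeil a s)
    rw [one_mul] at this
    refine this.congr fun k => ?_
    simp only [hG, hN, Function.comp_apply]
    ring
  have hmain := tendsto_integral_of_dominated_convergence bound hmeas hbi
    (fun k => Eventually.of_forall (hle k)) (Eventually.of_forall hpt)
  rw [integral_gaussian] at hmain
  refine hmain.congr' ?_
  filter_upwards [eventually_gt_atTop 0] with k hk
  have hk0 : (0 : ℝ) < k := Nat.cast_pos.mpr hk
  set φ := fun y : ℝ => h ⌈y⌉₊ * laplaceWeight a k ⌈y⌉₊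
  have hGφ : G k = fun s => (k : ℝ) ^ 4 * φ ((k : ℝ) ^ 4 + (k : ℝ) ^ 3 * s) := rfl
  have hGi : Integrable (G k) := hbi.mono' (hmeas k) (Eventually.of_forall (hle k))
  have hφi : Integrable φ := by
    rw [hGφ, integrable_const_mul_iff (by simpa using hk0.ne'),
      integrable_comp_mul_left_iff (fun t => φ ((k : ℝ) ^ 4 + t)) (by positivity)] at hGi
    refine (hGi.comp_add_left (-((k : ℝ) ^ 4))).congr (Eventually.of_forall fun t => ?_)
    simp only [add_neg_cancel_left]
  rw [(hasSum_of_integrable_comp_natCeil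
    (g := fun n => h n * laplaceWeight a k n) (by simp [laplaceWeight]) hφi).tsum_eq, hGφ,
    integral_const_mul, Measure.integral_comp_mul_left (fun t => φ ((k : ℝ) ^ 4 + t)),
    integral_add_left_eq_self φ, abs_of_pos (by positivity), smul_eq_mul, ← mul_assoc]
  congr 1
  field_simp

lemma hasSum_partition_exp {x : ℝ} (hx : 0 < x) :
    HasSum (fun n : ℕ => (p n : ℝ) * Real.exp (-x) ^ n) (eulerProd x)⁻¹ :=
  hasSum_partition (Real.exp_pos _).le (by simpa)
    (multipliable_eulerProd hx).hasProd.tendsto_prod_nat (eulerProd_ne_zero hx)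

lemma tsum_mul_laplaceWeight {a b k : ℝ} (ha : 0 < a) (hk : 0 < k) :
    ∑' n : ℕ, (p n : ℝ) * (b * n) / Real.exp (2 * a * √n) * laplaceWeight a k n =
      b * Real.exp (-(a * k ^ 2)) * ((eulerProd (a / k ^ 2))⁻¹ - 1) := by
  have hs := (hasSum_partition_exp (x := a / k ^ 2) (by positivity)).sub (hasSum_ite_eq 0 1)
  rw [← (hs.mul_left (b * Real.exp (-(a * k ^ 2)))).tsum_eq]
  refine tsum_congr fun n => ?_
  rcases Nat.eq_zero_or_pos n with rfl | hn
  · simp [laplaceWeight, p]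
  have hn0 : (n : ℝ) ≠ 0 := by positivity
  have he : Real.exp (-(a / k ^ 2 * (√n - k ^ 2) ^ 2)) =
      Real.exp (2 * a * √n) * (Real.exp (-(a * k ^ 2)) * Real.exp (-(a / k ^ 2)) ^ n) := by
    rw [← Real.exp_nat_mul, ← Real.exp_add, ← Real.exp_add]
    congr 1
    have := Real.sq_sqrt (Nat.cast_nonneg (α := ℝ) n)
    field_simp
    linear_combination (-1 : ℝ) * this
  rw [laplaceWeight, he, if_neg hn.ne', sub_zero]
  field_simp

lemma mul_exp_mul_inv_eulerProd {a k : ℝ} (ha : 0 < a) (ha2 : a ^ 2 = Real.pi ^ 2 / 6)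
    (hk : 0 < k) :
    k * Real.exp (-(a * k ^ 2)) * (eulerProd (a / k ^ 2))⁻¹ =
      √(a / (2 * Real.pi)) * Real.exp (-(a / k ^ 2) / 24) *
        (eulerProd (4 * Real.pi ^ 2 / a * k ^ 2))⁻¹ := by
  have hpi := Real.pi_pos
  have h := eulerProd_inversion (y := a / (2 * Real.pi) / k ^ 2) (by positivity)
  have h1 : 2 * Real.pi * (a / (2 * Real.pi) / k ^ 2) = a / k ^ 2 := by field_simp
  have h2 : 2 * Real.pi * (a / (2 * Real.pi) / k ^ 2)⁻¹ = 4 * Real.pi ^ 2 / a * k ^ 2 := by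
    field_simp
    ring
  have h3 : -(4 * Real.pi ^ 2 / a * k ^ 2) / 24 = -(a * k ^ 2) := by
    field_simp
    linear_combination 24 * ha2
  rw [h1, h2, h3, Real.sqrt_div' _ (by positivity), Real.sqrt_sq hk.le] at h
  have hD1 := eulerProd_ne_zero (x := a / k ^ 2) (by positivity)
  have hD2 := eulerProd_ne_zero (x := 4 * Real.pi ^ 2 / a * k ^ 2) (by positivity)
  rw [← div_eq_mul_inv, ← div_eq_mul_inv, div_eq_div_iff hD1 hD2, mul_assoc k, h]
  field_simp

lemma tendsto_mul_exp_mul_inv_eulerProd {a : ℝ} (ha : 0 < a) (ha2 : a ^ 2 = Real.pi ^ 2 / 6) :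
    Tendsto (fun k : ℕ => (k : ℝ) * Real.exp (-(a * (k : ℝ) ^ 2)) *
      (eulerProd (a / (k : ℝ) ^ 2))⁻¹) atTop (nhds √(a / (2 * Real.pi))) := by
  have hpi := Real.pi_pos
  have hk2 : Tendsto (fun k : ℕ => (k : ℝ) ^ 2) atTop atTop :=
    (tendsto_pow_atTop two_ne_zero).comp tendsto_natCast_atTop_atTop
  have h1 : Tendsto (fun k : ℕ => Real.exp (-(a / (k : ℝ) ^ 2) / 24)) atTop (nhds 1) := by
    simpa using ((hk2.const_div_atTop a).neg.div_const 24).rexp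
  have h2 := (tendsto_eulerProd_atTop.comp
    (hk2.const_mul_atTop (by positivity : 0 < 4 * Real.pi ^ 2 / a))).inv₀ one_ne_zero
  have h3 := (h1.const_mul √(a / (2 * Real.pi))).mul h2
  rw [mul_one, inv_one, mul_one] at h3
  refine h3.congr' ?_
  filter_upwards [eventually_gt_atTop 0] with k hk
  exact (mul_exp_mul_inv_eulerProd ha ha2 (Nat.cast_pos.mpr hk)).symm

lemma tendsto_mul_exp_neg_mul_sq {a : ℝ} (ha : 0 < a) :
    Tendsto (fun k : ℕ => (k : ℝ) * Real.exp (-(a * (k : ℝ) ^ 2))) atTop (nhds 0) := by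
  refine squeeze_zero' (Eventually.of_forall fun k => by positivity) ?_
    (tendsto_const_div_atTop_nhds_zero_nat a⁻¹)
  filter_upwards [eventually_gt_atTop 0] with k hk
  have hk0 : (0 : ℝ) < k := Nat.cast_pos.mpr hk
  have h := Real.add_one_le_exp (a * (k : ℝ) ^ 2)
  rw [Real.exp_neg, ← div_eq_mul_inv, inv_eq_one_div, div_div,
    div_le_div_iff₀ (Real.exp_pos _) (by positivity)]
  nlinarith

/-- If `p n ∼ e^{c√n}/(bn)` as `n → ∞` for some real `b`, then `b = 4√3`. -/
theorem erdos_constant (b : ℝ)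
    (hb : Tendsto (fun n : ℕ => (p n : ℝ) * (b * n) / Real.exp (c * Real.sqrt n))
      atTop (nhds 1)) :
    b = 4 * Real.sqrt 3 := by
  have hpi := Real.pi_pos
  obtain ⟨a, hca⟩ : ∃ a, c = 2 * a := ⟨√(Real.pi ^ 2 / 6), rfl⟩
  have ha_eq : a = √(Real.pi ^ 2 / 6) := by
    have : c = 2 * √(Real.pi ^ 2 / 6) := rfl
    linarith
  have ha : 0 < a := by rw [ha_eq]; positivity
  have ha2 : a ^ 2 = Real.pi ^ 2 / 6 := by rw [ha_eq, Real.sq_sqrt (by positivity)]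
  rw [hca] at hb
  obtain ⟨H, hH⟩ := hb.norm.bddAbove_range
  have hlaplace := tendsto_mul_tsum_laplaceWeight ha
    (fun n => hH (Set.mem_range_self n)) hb
  have hmodular := ((tendsto_mul_exp_mul_inv_eulerProd ha ha2).sub
    (tendsto_mul_exp_neg_mul_sq ha)).const_mul b
  have heq : √(Real.pi / (a / 4)) = b * √(a / (2 * Real.pi)) := by
    rw [sub_zero] at hmodular
    refine tendsto_nhds_unique hlaplace (hmodular.congr' ?_)
    filter_upwards [eventually_gt_atTop 0] with k hk
    rw [tsum_mul_laplaceWeight ha (Nat.cast_pos.mpr hk)]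
    ring
  have hb0 : 0 ≤ b := by
    have h1 : 0 < √(a / (2 * Real.pi)) := by positivity
    refine nonneg_of_mul_nonneg_left ?_ h1
    rw [← heq]
    positivity
  have hb2 : b ^ 2 = 48 := by
    have h := congrArg (· ^ 2) heq
    simp only [mul_pow] at h
    rw [Real.sq_sqrt (by positivity), Real.sq_sqrt (by positivity)] at h
    field_simp at h
    have : Real.pi ^ 2 * (b ^ 2 - 48) = 0 := by
      linear_combination 6 * (-h) - 6 * b ^ 2 * ha2
    have := (mul_eq_zero.mp this).resolve_left (by positivity)
    linarith
  rw [← sq_eq_sq₀ hb0 (by positivity), hb2, mul_pow, Real.sq_sqrt (by norm_num)]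
  norm_num
end

section
/- For every natural number n, s(n) = Σ_r p((n − r(r+1)/2)/4), where the sum is over all non-negative integers r such that n − r(r+1)/2 is a non-negative integer divisible by 4. -/
/-- The multiset of parts of the conjugate partition: the `j`-th part of the conjugate of
`λ` is `λ´_j = #{i : λ_i ≥ j}`, for those `j ≥ 1` for which this is positive. -/
def conjParts {n : ℕ} (P : n.Partition) : Multiset ℕ :=
  (((Finset.Icc 1 n).val.map fun j => (P.parts.filter fun a => j ≤ a).card).filter
    fun m => 0 < m)

/-- `s n` is the number of self-conjugate partitions of `n`. -/
def s (n : ℕ) : ℕ := Fintype.card {P : n.Partition // P.parts = conjParts P}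

/-- The `k`-element subsets of `{0, …, M - 1}` whose sum exceeds the least possible one by `e`. -/
def subsetsWithExcess (M k : ℕ) (e : ℤ) : Set (Finset ℕ) :=
  {Y | Y ⊆ Finset.range M ∧ Y.card = k ∧ 2 * ∑ y ∈ Y, (y : ℤ) = k * (k - 1) + 2 * e}

/-- The multisets of `k` natural numbers, all at most `a`, whose sum is `e`. -/
def boxedMultisets (k a : ℕ) (e : ℤ) : Set (Multiset ℕ) :=
  {m | m.card = k ∧ (∀ x ∈ m, x ≤ a) ∧ (m.sum : ℤ) = e}

lemma boxedMultisets_succ_succ (k a : ℕ) (e : ℤ) :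
    boxedMultisets (k + 1) (a + 1) e = boxedMultisets (k + 1) a e ∪
      (fun m => (a + 1) ::ₘ m) '' boxedMultisets k (a + 1) (e - (a + 1)) := by
  ext m
  simp only [boxedMultisets, Set.mem_union, Set.mem_image, Set.mem_ofPred_eq]
  constructor
  · rintro ⟨h1, h2, h3⟩
    by_cases hm : a + 1 ∈ m
    · right
      obtain ⟨t, rfl⟩ := Multiset.exists_cons_of_mem hm
      refine ⟨t, ⟨by simpa using h1, fun x hx => h2 x (Multiset.mem_cons_of_mem hx), ?_⟩, rfl⟩
      rw [Multiset.sum_cons, Nat.cast_add, Nat.cast_add_one] at h3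
      linarith
    · left
      refine ⟨h1, fun x hx => ?_, h3⟩
      have := h2 x hx
      have : x ≠ a + 1 := fun h => hm (h ▸ hx)
      omega
  · rintro (⟨h1, h2, h3⟩ | ⟨t, ⟨h1, h2, h3⟩, rfl⟩)
    · exact ⟨h1, fun x hx => (h2 x hx).trans (Nat.le_succ a), h3⟩
    · refine ⟨by simp [h1], ?_, ?_⟩
      · simpa using h2
      · rw [Multiset.sum_cons, Nat.cast_add, Nat.cast_add_one]
        linarith

lemma subsetsWithExcess_succ_succ (k a : ℕ) (e : ℤ) :
    subsetsWithExcess (k + a + 2) (k + 1) e = subsetsWithExcess (k + a + 1) (k + 1) e ∪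
      (fun Y => insert (k + a + 1) Y) '' subsetsWithExcess (k + a + 1) k (e - (a + 1)) := by
  ext Y
  simp only [subsetsWithExcess, Set.mem_union, Set.mem_image, Set.mem_ofPred_eq]
  constructor
  · rintro ⟨h1, h2, h3⟩
    by_cases hm : k + a + 1 ∈ Y
    · right
      refine ⟨Y.erase (k + a + 1), ⟨?_, ?_, ?_⟩, Finset.insert_erase hm⟩
      · intro y hy
        have := h1 (Finset.mem_of_mem_erase hy)
        have := Finset.ne_of_mem_erase hy
        simp only [Finset.mem_range] at *
        omega
      · rw [Finset.card_erase_of_mem hm, h2]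
        rfl
      · rw [← Finset.add_sum_erase _ _ hm] at h3
        push_cast at h3
        linarith
    · left
      refine ⟨fun y hy => ?_, h2, h3⟩
      have := h1 hy
      have : y ≠ k + a + 1 := fun h => hm (h ▸ hy)
      simp only [Finset.mem_range] at *
      omega
  · rintro (⟨h1, h2, h3⟩ | ⟨Z, ⟨h1, h2, h3⟩, rfl⟩)
    · exact ⟨h1.trans (Finset.range_mono (by omega)), h2, h3⟩
    · have hZ : k + a + 1 ∉ Z := fun h => by simpa using h1 h
      refine ⟨?_, ?_, ?_⟩
      · intro y hy
        rcases Finset.mem_insert.1 hy with rfl | hy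
        · simp
        · have := h1 hy
          simp only [Finset.mem_range] at *
          omega
      · rw [Finset.card_insert_of_notMem hZ, h2]
      · rw [Finset.sum_insert hZ]
        push_cast
        linarith

/-- Subtracting the least possible sum turns subsets into multisets in a box. -/
lemma encard_subsetsWithExcess (k a : ℕ) (e : ℤ) :
    (subsetsWithExcess (k + a) k e).encard = (boxedMultisets k a e).encard := by
  induction k generalizing a e with
  | zero =>
    by_cases he : e = 0
    · have h1 : subsetsWithExcess (0 + a) 0 e = {∅} := by
        ext Y
        simp only [subsetsWithExcess, Set.mem_ofPred_eq, Finset.card_eq_zero,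
          Set.mem_singleton_iff]
        constructor
        · exact fun h => h.2.1
        · rintro rfl
          simp [he]
      have h2 : boxedMultisets 0 a e = {0} := by
        ext m
        simp only [boxedMultisets, Set.mem_ofPred_eq, Multiset.card_eq_zero,
          Set.mem_singleton_iff]
        constructor
        · exact fun h => h.1
        · rintro rfl
          simp [he]
      rw [h1, h2, Set.encard_singleton, Set.encard_singleton]
    · have h1 : subsetsWithExcess (0 + a) 0 e = ∅ := by
        ext Y
        simp only [subsetsWithExcess, Set.mem_ofPred_eq, Finset.card_eq_zero,
          Set.mem_empty_iff_false, iff_false]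
        rintro ⟨-, rfl, h⟩
        simp at h
        omega
      have h2 : boxedMultisets 0 a e = ∅ := by
        ext m
        simp only [boxedMultisets, Set.mem_ofPred_eq, Multiset.card_eq_zero,
          Set.mem_empty_iff_false, iff_false]
        rintro ⟨rfl, -, h⟩
        simp at h
        omega
      rw [h1, h2, Set.encard_empty, Set.encard_empty]
  | succ k ihk =>
    induction a generalizing e with
    | zero =>
      have hsum : 2 * ∑ y ∈ Finset.range (k + 1), (y : ℤ) =
          ((k + 1 : ℕ) : ℤ) * ((k + 1 : ℕ) - 1) := by
        have := Finset.sum_range_id_mul_two (k + 1)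
        zify at this
        push_cast at this ⊢
        linarith
      have h1 : ∀ Y ∈ subsetsWithExcess (k + 1 + 0) (k + 1) e, Y = Finset.range (k + 1) :=
        fun Y hY => Finset.eq_of_subset_of_card_le hY.1 (by simp [hY.2.1])
      have h2 : ∀ m ∈ boxedMultisets (k + 1) 0 e, m = Multiset.replicate (k + 1) 0 :=
        fun m hm => Multiset.eq_replicate.2 ⟨hm.1, fun x hx => Nat.le_zero.1 (hm.2.1 x hx)⟩
      by_cases he : e = 0
      · have h1' : subsetsWithExcess (k + 1 + 0) (k + 1) e = {Finset.range (k + 1)} := by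
          refine Set.eq_singleton_iff_unique_mem.2 ⟨⟨subset_rfl, by simp, ?_⟩, h1⟩
          rw [hsum, he]
          ring
        have h2' : boxedMultisets (k + 1) 0 e = {Multiset.replicate (k + 1) 0} := by
          refine Set.eq_singleton_iff_unique_mem.2 ⟨⟨by simp, ?_, by simp [he]⟩, h2⟩
          exact fun x hx => (Multiset.eq_of_mem_replicate hx).le
        simp [h1', h2']
      · have h1' : subsetsWithExcess (k + 1 + 0) (k + 1) e = ∅ := by
          refine Set.eq_empty_of_forall_notMem fun Y hY => he ?_
          have h := hY.2.2
          rw [h1 Y hY, hsum] at h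
          linarith
        have h2' : boxedMultisets (k + 1) 0 e = ∅ := by
          refine Set.eq_empty_of_forall_notMem fun m hm => he ?_
          have h := hm.2.2
          rw [h2 m hm] at h
          simpa using h.symm
        simp [h1', h2']
    | succ a iha =>
      have e1 : k + 1 + (a + 1) = k + a + 2 := by omega
      have e2 : k + a + 1 = k + 1 + a := by omega
      have e3 : k + a + 1 = k + (a + 1) := by omega
      rw [e1, subsetsWithExcess_succ_succ, boxedMultisets_succ_succ, Set.encard_union_eq,
        Set.encard_union_eq, Set.InjOn.encard_image, Set.InjOn.encard_image]
      · rw [← ihk (a + 1), ← iha, e3, ← e3, e2]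
      · exact fun x _ y _ h => by simpa using h
      · intro x hx y hy h
        have hx' : k + a + 1 ∉ x := fun h => by simpa using hx.1 h
        have hy' : k + a + 1 ∉ y := fun h => by simpa using hy.1 h
        rw [← Finset.erase_insert hx', ← Finset.erase_insert hy']
        exact congrArg (fun Y => Finset.erase Y (k + a + 1)) h
      · rw [Set.disjoint_left]
        rintro _ hm ⟨t, -, rfl⟩
        have := hm.2.1 (a + 1) (by simp)
        omega
      · rw [Set.disjoint_left]
        rintro _ hm ⟨t, -, rfl⟩
        have := hm.1 (Finset.mem_insert_self _ _)
        simp at this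

lemma encard_boxedMultisets {k a e : ℕ} (hk : e ≤ k) (ha : e ≤ a) :
    (boxedMultisets k a e).encard = p e := by
  have hcard : ∀ P : e.Partition, P.parts.card ≤ k := fun P => by
    have h := Multiset.card_nsmul_le_sum (s := P.parts) (a := 1) (fun x hx => P.parts_pos hx)
    rw [P.parts_sum] at h
    simp at h
    omega
  have himage : boxedMultisets k a e = (fun P : e.Partition =>
      P.parts + Multiset.replicate (k - P.parts.card) 0) '' Set.univ := by
    ext m
    simp only [Set.image_univ, Set.mem_range]
    constructor
    · rintro ⟨h1, h2, h3⟩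
      refine ⟨Nat.Partition.ofSums e m (by exact_mod_cast h3), ?_⟩
      have h := Multiset.filter_add_not (fun x => x ≠ 0) m
      have hz : m.filter (fun x => ¬ x ≠ 0) =
          Multiset.replicate (k - (m.filter (fun x => x ≠ 0)).card) 0 := by
        refine Multiset.eq_replicate.2 ⟨?_, fun x hx => by simpa using (Multiset.mem_filter.1 hx).2⟩
        have := congrArg Multiset.card h
        rw [Multiset.card_add, h1] at this
        omega
      rw [Nat.Partition.ofSums_parts, ← hz, h]
    · rintro ⟨P, rfl⟩
      refine ⟨?_, ?_, ?_⟩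
      · have := hcard P
        simp only [Multiset.card_add, Multiset.card_replicate]
        omega
      · intro x hx
        rcases Multiset.mem_add.1 hx with hx | hx
        · exact (Nat.Partition.le_of_mem_parts hx).trans ha
        · simp [Multiset.eq_of_mem_replicate hx]
      · simp [P.parts_sum]
  rw [himage, Set.InjOn.encard_image, Set.encard_univ, p, ENat.card_eq_coe_fintype_card]
  intro P _ Q _ h
  have key : ∀ R : e.Partition,
      (R.parts + Multiset.replicate (k - R.parts.card) 0).filter (fun x => x ≠ 0) = R.parts := by
    intro R
    rw [Multiset.filter_add, Multiset.filter_eq_self.2 fun x hx => (R.parts_pos hx).ne',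
      Multiset.filter_eq_nil.2 fun x hx => by simp [Multiset.eq_of_mem_replicate hx], add_zero]
  ext1
  rw [← key P, ← key Q]
  exact congrArg (Multiset.filter fun x => x ≠ 0) h

/-- The sets of natural numbers `A ⊆ {0, …, k - 1}` for which the distinct odd numbers `2 a + 1`,
`a ∈ A`, add up to `n`. -/
def oddSumSubsets (k : ℕ) (n : ℤ) : Set (Finset ℕ) :=
  {A | A ⊆ Finset.range k ∧ ∑ a ∈ A, (2 * a + 1 : ℤ) = n}

/-- The subsets `Y ⊆ {0, …, 2 N - 1}` of energy `n`; particles sit at the positions `y - N`,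
and the vacuum is the set of negative positions. -/
def energySubsets (N : ℕ) (n : ℤ) : Set (Finset ℕ) :=
  {Y | Y ⊆ Finset.range (2 * N) ∧
    ∑ y ∈ Y, (4 * (y - N) + 1 : ℤ) + ∑ i ∈ Finset.range N, (4 * i + 3 : ℤ) = n}

/-- Even elements become particles at non-negative positions, odd elements become holes at negative
positions. -/
def toParticles (N : ℕ) (A : Finset ℕ) : Finset ℕ :=
  (Finset.range (2 * N)).filter fun y =>
    (N ≤ y ∧ 2 * (y - N) ∈ A) ∨ (y < N ∧ 2 * (N - 1 - y) + 1 ∉ A)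

/-- The inverse of `toParticles`. -/
def ofParticles (N : ℕ) (Y : Finset ℕ) : Finset ℕ :=
  (Finset.range (2 * N)).filter fun a =>
    (a % 2 = 0 ∧ N + a / 2 ∈ Y) ∨ (a % 2 = 1 ∧ N - 1 - a / 2 ∉ Y)

lemma ofParticles_toParticles {N : ℕ} {A : Finset ℕ} (hA : A ⊆ Finset.range (2 * N)) :
    ofParticles N (toParticles N A) = A := by
  ext a
  have hlt : a ∈ A → a < 2 * N := fun h => Finset.mem_range.1 (hA h)
  simp only [ofParticles, toParticles, Finset.mem_filter, Finset.mem_range]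
  rcases Nat.even_or_odd' a with ⟨i, rfl | rfl⟩
  · have h1 : 2 * i / 2 = i := by omega
    have h2 : N + i - N = i := by omega
    simp only [h1, h2]
    constructor
    · rintro ⟨h, ⟨-, -, h' | h'⟩ | h'⟩
      · exact h'.2
      · omega
      · omega
    · exact fun h => ⟨hlt h, Or.inl ⟨by omega, by have := hlt h; omega, Or.inl ⟨by omega, h⟩⟩⟩
  · have h1 : (2 * i + 1) / 2 = i := by omega
    simp only [h1]
    constructor
    · rintro ⟨h, h' | ⟨-, h'⟩⟩
      · omega
      · by_contra hn
        refine h' ⟨by omega, Or.inr ⟨by omega, ?_⟩⟩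
        rwa [show N - 1 - (N - 1 - i) = i by omega]
    · intro h
      have := hlt h
      refine ⟨this, Or.inr ⟨by omega, ?_⟩⟩
      rintro ⟨-, h' | ⟨-, h'⟩⟩
      · omega
      · rw [show N - 1 - (N - 1 - i) = i by omega] at h'
        exact h' h

lemma toParticles_ofParticles {N : ℕ} {Y : Finset ℕ} (hY : Y ⊆ Finset.range (2 * N)) :
    toParticles N (ofParticles N Y) = Y := by
  ext y
  have hlt : y ∈ Y → y < 2 * N := fun h => Finset.mem_range.1 (hY h)
  simp only [ofParticles, toParticles, Finset.mem_filter, Finset.mem_range]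
  rcases le_or_gt N y with hy | hy
  · have h1 : N + 2 * (y - N) / 2 = y := by omega
    simp only [h1]
    constructor
    · rintro ⟨h, ⟨-, -, h' | h'⟩ | h'⟩
      · exact h'.2
      · omega
      · omega
    · intro h
      have := hlt h
      exact ⟨this, Or.inl ⟨hy, by omega, Or.inl ⟨by omega, h⟩⟩⟩
  · have h1 : N - 1 - (2 * (N - 1 - y) + 1) / 2 = y := by omega
    simp only [h1]
    constructor
    · rintro ⟨h, h' | ⟨-, h'⟩⟩
      · omega
      · by_contra hn
        exact h' ⟨by omega, Or.inr ⟨by omega, hn⟩⟩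
    · intro h
      refine ⟨hlt h, Or.inr ⟨hy, ?_⟩⟩
      rintro ⟨-, h' | ⟨-, h'⟩⟩
      · omega
      · exact h' h

lemma sum_range_two_mul (f : ℕ → ℤ) (N : ℕ) :
    ∑ a ∈ Finset.range (2 * N), f a =
      ∑ i ∈ Finset.range N, (f (2 * i) + f (2 * i + 1)) := by
  induction N with
  | zero => simp
  | succ N ih =>
    rw [show 2 * (N + 1) = 2 * N + 1 + 1 by ring, Finset.sum_range_succ, Finset.sum_range_succ, ih,
      Finset.sum_range_succ, add_assoc]

lemma sum_range_two_mul_center (f : ℕ → ℤ) (N : ℕ) :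
    ∑ a ∈ Finset.range (2 * N), f a =
      ∑ i ∈ Finset.range N, (f (N + i) + f (N - 1 - i)) := by
  rw [two_mul, Finset.sum_range_add, Finset.sum_add_distrib, Finset.sum_range_reflect, add_comm]

lemma energy_toParticles {N : ℕ} {A : Finset ℕ} (hA : A ⊆ Finset.range (2 * N)) :
    ∑ y ∈ toParticles N A, (4 * (y - N) + 1 : ℤ) + ∑ i ∈ Finset.range N, (4 * i + 3 : ℤ) =
      ∑ a ∈ A, (2 * a + 1 : ℤ) := by
  have hA' : A = (Finset.range (2 * N)).filter (· ∈ A) := by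
    ext a
    simpa using fun h => Finset.mem_range.1 (hA h)
  conv_rhs => rw [hA']
  rw [Finset.sum_filter, sum_range_two_mul, toParticles, Finset.sum_filter,
    sum_range_two_mul_center, ← Finset.sum_add_distrib]
  refine Finset.sum_congr rfl fun i hi => ?_
  have hi : i < N := Finset.mem_range.1 hi
  have h1 : N + i - N = i := by omega
  have h2 : N - 1 - (N - 1 - i) = i := by omega
  have h3 : ((N - 1 - i : ℕ) : ℤ) = N - 1 - i := by omega
  have h4 : ¬ (N ≤ N - 1 - i) := by omega
  have h5 : N - 1 - i < N := by omega
  have h6 : ¬ (N + i < N) := by omega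
  simp only [h1, h2, h3, h4, h5, h6, le_add_iff_nonneg_right, zero_le, true_and, false_and,
    or_false, false_or]
  by_cases ha : 2 * i ∈ A <;> by_cases hb : 2 * i + 1 ∈ A <;>
    simp only [ha, hb, if_true, if_false, not_true, not_false_iff] <;> push_cast <;> ring

lemma encard_oddSumSubsets (N : ℕ) (n : ℤ) :
    (oddSumSubsets (2 * N) n).encard = (energySubsets N n).encard := by
  have himage : energySubsets N n = toParticles N '' oddSumSubsets (2 * N) n := by
    ext Y
    constructor
    · rintro ⟨h1, h2⟩
      have hsub : ofParticles N Y ⊆ Finset.range (2 * N) := Finset.filter_subset _ _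
      refine ⟨ofParticles N Y, ⟨hsub, ?_⟩, toParticles_ofParticles h1⟩
      rw [← energy_toParticles hsub, toParticles_ofParticles h1, h2]
    · rintro ⟨A, ⟨h1, h2⟩, rfl⟩
      exact ⟨Finset.filter_subset _ _, (energy_toParticles h1).trans h2⟩
  rw [himage, Set.InjOn.encard_image]
  intro A hA B hB h
  rw [← ofParticles_toParticles hA.1, h, ofParticles_toParticles hB.1]

/-- The self-conjugate Young diagrams with `n` cells and fewer than `k + 1` rows. -/
def selfConjugateDiagrams (k : ℕ) (n : ℤ) : Set YoungDiagram :=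
  {μ | μ.transpose = μ ∧ (k, 0) ∉ μ ∧ (μ.card : ℤ) = n}

lemma YoungDiagram.mem_comm_of_transpose_eq {μ : YoungDiagram} (h : μ.transpose = μ) {i j : ℕ} :
    (i, j) ∈ μ ↔ (j, i) ∈ μ := by
  conv_lhs => rw [← h]
  simp

lemma YoungDiagram.lt_of_mem_of_transpose_eq {μ : YoungDiagram} (h : μ.transpose = μ) {i j k : ℕ}
    (hk : (k, 0) ∉ μ) (hij : (i, j) ∈ μ) : i < k ∧ j < k := by
  constructor
  · by_contra! hi
    exact hk (μ.up_left_mem hi (Nat.zero_le j) hij)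
  · by_contra! hj
    exact hk ((mem_comm_of_transpose_eq h).1 (μ.up_left_mem (Nat.zero_le i) hj hij))

/-- Add to `μ` a new first row and a new first column, both of length `k + 1`. -/
def addHook (k : ℕ) (μ : YoungDiagram) : YoungDiagram where
  cells := (Finset.range (k + 1) ×ˢ Finset.range (k + 1)).filter fun c =>
    c.1 = 0 ∨ c.2 = 0 ∨ (c.1 - 1, c.2 - 1) ∈ μ
  isLowerSet := by
    rintro ⟨i, j⟩ ⟨i', j'⟩ ⟨hi, hj⟩ h
    simp only [Finset.coe_filter, Finset.mem_product, Finset.mem_range, Set.mem_ofPred_eq] at *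
    refine ⟨by omega, ?_⟩
    by_cases hi0 : i' = 0
    · exact Or.inl hi0
    by_cases hj0 : j' = 0
    · exact Or.inr (Or.inl hj0)
    rcases h.2 with h | h | h
    · omega
    · omega
    · exact Or.inr (Or.inr (μ.up_left_mem (by omega) (by omega) h))

/-- Remove the first row and the first column. -/
noncomputable def removeHook (μ : YoungDiagram) : YoungDiagram where
  cells := μ.cells.preimage (Prod.map Nat.succ Nat.succ)
    (Nat.succ_injective.prodMap Nat.succ_injective).injOn
  isLowerSet := by
    rintro ⟨i, j⟩ ⟨i', j'⟩ ⟨hi, hj⟩ h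
    simp only [Finset.coe_preimage, Set.mem_preimage, Prod.map_apply, Finset.mem_coe,
      YoungDiagram.mem_cells] at *
    exact μ.up_left_mem (Nat.succ_le_succ hi) (Nat.succ_le_succ hj) h

lemma mem_addHook {k : ℕ} {μ : YoungDiagram} {i j : ℕ} : (i, j) ∈ addHook k μ ↔
    (i < k + 1 ∧ j < k + 1) ∧ (i = 0 ∨ j = 0 ∨ (i - 1, j - 1) ∈ μ) := by
  rw [← YoungDiagram.mem_cells]
  simp [addHook, -YoungDiagram.mem_cells]

lemma mem_removeHook {μ : YoungDiagram} {i j : ℕ} :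
    (i, j) ∈ removeHook μ ↔ (i + 1, j + 1) ∈ μ := by
  rw [← YoungDiagram.mem_cells, removeHook, Finset.mem_preimage]
  rfl

lemma removeHook_addHook {k : ℕ} {μ : YoungDiagram} (h : μ.transpose = μ) (hk : (k, 0) ∉ μ) :
    removeHook (addHook k μ) = μ := by
  ext ⟨i, j⟩
  rw [YoungDiagram.mem_cells, YoungDiagram.mem_cells, mem_removeHook, mem_addHook]
  constructor
  · rintro ⟨-, h | h | h⟩
    · omega
    · omega
    · exact h
  · intro hij
    have := YoungDiagram.lt_of_mem_of_transpose_eq h hk hij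
    exact ⟨by omega, Or.inr (Or.inr hij)⟩

lemma addHook_removeHook {k : ℕ} {μ : YoungDiagram} (h : μ.transpose = μ) (hk : (k, 0) ∈ μ)
    (hk' : (k + 1, 0) ∉ μ) : addHook k (removeHook μ) = μ := by
  ext ⟨i, j⟩
  rw [YoungDiagram.mem_cells, YoungDiagram.mem_cells, mem_addHook, mem_removeHook]
  constructor
  · rintro ⟨⟨hi, hj⟩, h'⟩
    by_cases hi0 : i = 0
    · subst hi0
      exact (YoungDiagram.mem_comm_of_transpose_eq h).1 (μ.up_left_mem (by omega) le_rfl hk)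
    by_cases hj0 : j = 0
    · subst hj0
      exact μ.up_left_mem (by omega) le_rfl hk
    rcases h' with h' | h' | h'
    · exact absurd h' hi0
    · exact absurd h' hj0
    · rwa [Nat.sub_add_cancel (by omega), Nat.sub_add_cancel (by omega)] at h'
  · intro hij
    refine ⟨YoungDiagram.lt_of_mem_of_transpose_eq h hk' hij, ?_⟩
    by_cases hi0 : i = 0
    · exact Or.inl hi0
    by_cases hj0 : j = 0
    · exact Or.inr (Or.inl hj0)
    rw [Nat.sub_add_cancel (by omega), Nat.sub_add_cancel (by omega)]
    exact Or.inr (Or.inr hij)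

lemma transpose_addHook {k : ℕ} {μ : YoungDiagram} (h : μ.transpose = μ) :
    (addHook k μ).transpose = addHook k μ := by
  ext ⟨i, j⟩
  rw [YoungDiagram.mem_cells, YoungDiagram.mem_cells, YoungDiagram.mem_transpose, Prod.swap_prod_mk,
    mem_addHook, mem_addHook, YoungDiagram.mem_comm_of_transpose_eq h]
  tauto

lemma transpose_removeHook {μ : YoungDiagram} (h : μ.transpose = μ) :
    (removeHook μ).transpose = removeHook μ := by
  ext ⟨i, j⟩
  rw [YoungDiagram.mem_cells, YoungDiagram.mem_cells, YoungDiagram.mem_transpose, Prod.swap_prod_mk,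
    mem_removeHook, mem_removeHook, YoungDiagram.mem_comm_of_transpose_eq h]

lemma card_addHook {k : ℕ} {μ : YoungDiagram} (h : μ.transpose = μ) (hk : (k, 0) ∉ μ) :
    (addHook k μ).card = μ.card + (2 * k + 1) := by
  have hcells : (addHook k μ).cells =
      μ.cells.image (Prod.map Nat.succ Nat.succ) ∪
        ((Finset.range (k + 1)).image (fun i => (i, 0)) ∪
          (Finset.range k).image (fun j => (0, j + 1))) := by
    ext ⟨i, j⟩
    rw [YoungDiagram.mem_cells, mem_addHook]
    simp only [Finset.mem_union, Finset.mem_image, Finset.mem_range, Prod.exists, Prod.map_apply,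
      Prod.mk.injEq, YoungDiagram.mem_cells]
    constructor
    · rintro ⟨⟨hi, hj⟩, h'⟩
      by_cases hj0 : j = 0
      · exact Or.inr (Or.inl ⟨i, hi, rfl, hj0.symm⟩)
      by_cases hi0 : i = 0
      · exact Or.inr (Or.inr ⟨j - 1, by omega, hi0.symm, by omega⟩)
      rcases h' with h' | h' | h'
      · exact absurd h' hi0
      · exact absurd h' hj0
      · exact Or.inl ⟨i - 1, j - 1, h', by omega, by omega⟩
    · rintro (⟨a, b, hab, rfl, rfl⟩ | ⟨a, ha, rfl, rfl⟩ | ⟨b, hb, rfl, rfl⟩)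
      · have := YoungDiagram.lt_of_mem_of_transpose_eq h hk hab
        exact ⟨by omega, Or.inr (Or.inr hab)⟩
      · exact ⟨by omega, Or.inr (Or.inl rfl)⟩
      · exact ⟨by omega, Or.inl rfl⟩
  rw [YoungDiagram.card, hcells, Finset.card_union_of_disjoint, Finset.card_union_of_disjoint,
    Finset.card_image_of_injective _ (Nat.succ_injective.prodMap Nat.succ_injective),
    Finset.card_image_of_injective, Finset.card_image_of_injective, Finset.card_range,
    Finset.card_range, YoungDiagram.card]
  · omega
  · intro a b hab
    simpa using hab
  · intro a b hab
    simpa using hab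
  · rw [Finset.disjoint_left]
    rintro ⟨i, j⟩ h1 h2
    simp only [Finset.mem_image, Prod.mk.injEq] at h1 h2
    obtain ⟨_, -, -, h1⟩ := h1
    obtain ⟨_, -, -, h2⟩ := h2
    omega
  · rw [Finset.disjoint_left]
    rintro ⟨i, j⟩ h1 h2
    simp only [Finset.mem_union, Finset.mem_image, Prod.mk.injEq, Prod.exists,
      Prod.map_apply] at h1 h2
    obtain ⟨_, _, -, h1, h1'⟩ := h1
    rcases h2 with ⟨_, -, -, h2⟩ | ⟨_, -, h2, -⟩ <;> omega

lemma selfConjugateDiagrams_succ (k : ℕ) (n : ℤ) :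
    selfConjugateDiagrams (k + 1) n =
      selfConjugateDiagrams k n ∪ addHook k '' selfConjugateDiagrams k (n - (2 * k + 1)) := by
  ext μ
  constructor
  · rintro ⟨h1, h2, h3⟩
    by_cases hk : (k, 0) ∈ μ
    · right
      have hr := transpose_removeHook h1
      have hk' : (k, 0) ∉ removeHook μ := fun h =>
        h2 (μ.up_left_mem le_rfl (Nat.zero_le _) (mem_removeHook.1 h))
      refine ⟨removeHook μ, ⟨hr, hk', ?_⟩, addHook_removeHook h1 hk h2⟩
      have := card_addHook hr hk'
      rw [addHook_removeHook h1 hk h2] at this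
      omega
    · exact Or.inl ⟨h1, hk, h3⟩
  · rintro (⟨h1, h2, h3⟩ | ⟨ν, ⟨h1, h2, h3⟩, rfl⟩)
    · exact ⟨h1, fun h => h2 (μ.up_left_mem (Nat.le_succ k) le_rfl h), h3⟩
    · refine ⟨transpose_addHook h1, fun h => ?_, ?_⟩
      · have := (mem_addHook.1 h).1.1
        omega
      · rw [card_addHook h1 h2]
        push_cast
        linarith

lemma oddSumSubsets_succ (k : ℕ) (n : ℤ) :
    oddSumSubsets (k + 1) n =
      oddSumSubsets k n ∪ (fun A => insert k A) '' oddSumSubsets k (n - (2 * k + 1)) := by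
  ext A
  constructor
  · rintro ⟨h1, h2⟩
    rw [Finset.range_add_one] at h1
    by_cases hk : k ∈ A
    · right
      refine ⟨A.erase k, ⟨Finset.subset_insert_iff.1 h1, ?_⟩, Finset.insert_erase hk⟩
      rw [← Finset.add_sum_erase _ _ hk] at h2
      linarith
    · exact Or.inl ⟨(Finset.subset_insert_iff_of_notMem hk).1 h1, h2⟩
  · rintro (⟨h1, h2⟩ | ⟨B, ⟨h1, h2⟩, rfl⟩)
    · exact ⟨h1.trans (Finset.range_mono (Nat.le_succ k)), h2⟩
    · have hk : k ∉ B := fun h => by simpa using h1 h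
      refine ⟨?_, ?_⟩
      · rw [Finset.range_add_one]
        exact Finset.insert_subset_insert k h1
      · rw [Finset.sum_insert hk]
        linarith

/-- Diagonal hooks identify self-conjugate diagrams with sets of distinct odd numbers. -/
lemma encard_selfConjugateDiagrams (k : ℕ) (n : ℤ) :
    (selfConjugateDiagrams k n).encard = (oddSumSubsets k n).encard := by
  induction k generalizing n with
  | zero =>
    have h1 : ∀ μ ∈ selfConjugateDiagrams 0 n, μ = ⊥ := by
      rintro μ ⟨-, h, -⟩
      ext ⟨i, j⟩
      simpa using fun hij => h (μ.up_left_mem (Nat.zero_le i) (Nat.zero_le j) hij)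
    have h2 : ∀ A ∈ oddSumSubsets 0 n, A = ∅ := fun A hA => by simpa using hA.1
    by_cases hn : n = 0
    · have h1' : selfConjugateDiagrams 0 n = {⊥} := by
        refine Set.eq_singleton_iff_unique_mem.2 ⟨⟨?_, by simp, by simp [hn]⟩, h1⟩
        ext
        simp
      have h2' : oddSumSubsets 0 n = {∅} :=
        Set.eq_singleton_iff_unique_mem.2 ⟨⟨by simp, by simp [hn]⟩, h2⟩
      rw [h1', h2', Set.encard_singleton, Set.encard_singleton]
    · have h1' : selfConjugateDiagrams 0 n = ∅ := by
        refine Set.eq_empty_of_forall_notMem fun μ hμ => hn ?_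
        have h := hμ.2.2
        rw [h1 μ hμ, YoungDiagram.card, YoungDiagram.cells_bot] at h
        simpa using h.symm
      have h2' : oddSumSubsets 0 n = ∅ := by
        refine Set.eq_empty_of_forall_notMem fun A hA => hn ?_
        have h := hA.2
        rw [h2 A hA] at h
        simpa using h.symm
      rw [h1', h2', Set.encard_empty, Set.encard_empty]
  | succ k ih =>
    rw [selfConjugateDiagrams_succ, oddSumSubsets_succ, Set.encard_union_eq, Set.encard_union_eq,
      Set.InjOn.encard_image, Set.InjOn.encard_image, ih, ih]
    · intro A hA B hB h
      have hA' : k ∉ A := fun h => by simpa using hA.1 h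
      have hB' : k ∉ B := fun h => by simpa using hB.1 h
      rw [← Finset.erase_insert hA', ← Finset.erase_insert hB']
      exact congrArg (fun Y => Finset.erase Y k) h
    · intro μ hμ ν hν h
      rw [← removeHook_addHook hμ.1 hμ.2.1, h, removeHook_addHook hν.1 hν.2.1]
    · rw [Set.disjoint_left]
      rintro _ hA ⟨B, -, rfl⟩
      simpa using hA.1 (Finset.mem_insert_self k B)
    · rw [Set.disjoint_left]
      rintro _ hμ ⟨ν, -, rfl⟩
      exact hμ.2.1 (mem_addHook.2 ⟨by omega, Or.inr (Or.inl rfl)⟩)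

namespace YoungDiagram

lemma sum_rowLens (μ : YoungDiagram) : μ.rowLens.sum = μ.card := by
  have h : ∀ c ∈ μ.cells, c.1 ∈ Finset.range (μ.colLen 0) := by
    rintro ⟨i, j⟩ hc
    exact Finset.mem_range.2 (mem_iff_lt_colLen.1 (μ.up_left_mem le_rfl (Nat.zero_le j) hc))
  rw [YoungDiagram.card, Finset.card_eq_sum_card_fiberwise h, ← Multiset.sum_coe]
  change ∑ i ∈ Finset.range (μ.colLen 0), μ.rowLen i = _
  exact Finset.sum_congr rfl fun i _ => μ.rowLen_eq_card

lemma rowLen_le_card (μ : YoungDiagram) (i : ℕ) : μ.rowLen i ≤ μ.card := by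
  rw [rowLen_eq_card]
  exact Finset.card_le_card (Finset.filter_subset _ _)

lemma colLen_le_card (μ : YoungDiagram) (j : ℕ) : μ.colLen j ≤ μ.card := by
  rw [colLen_eq_card]
  exact Finset.card_le_card (Finset.filter_subset _ _)

lemma eq_of_coe_rowLens_eq {μ ν : YoungDiagram}
    (h : (μ.rowLens : Multiset ℕ) = (ν.rowLens : Multiset ℕ)) : μ = ν := by
  have : μ.rowLens = ν.rowLens :=
    (Multiset.coe_eq_coe.1 h).eq_of_sortedGE μ.rowLens_sorted ν.rowLens_sorted
  exact equivListRowLens.injective (Subtype.ext this)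

lemma card_filter_rowLens (μ : YoungDiagram) (j : ℕ) :
    ((μ.rowLens : Multiset ℕ).filter fun a => j + 1 ≤ a).card = μ.colLen j := by
  have h : (μ.rowLens : Multiset ℕ) = (Finset.range (μ.colLen 0)).val.map μ.rowLen := rfl
  rw [h, Multiset.filter_map, Multiset.card_map, ← Finset.filter_val, Finset.card_val]
  have : (Finset.range (μ.colLen 0)).filter ((fun a => j + 1 ≤ a) ∘ μ.rowLen) =
      Finset.range (μ.colLen j) := by
    ext i
    simp only [Finset.mem_filter, Finset.mem_range, Function.comp_apply, Nat.succ_le_iff]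
    rw [← mem_iff_lt_rowLen, ← mem_iff_lt_colLen, ← mem_iff_lt_colLen]
    exact ⟨fun h => h.2, fun h => ⟨μ.up_left_mem le_rfl (Nat.zero_le j) h, h⟩⟩
  rw [this, Finset.card_range]

end YoungDiagram

lemma conjParts_eq_rowLens_transpose {n : ℕ} {P : n.Partition} {μ : YoungDiagram}
    (h : P.parts = μ.rowLens) : conjParts P = μ.transpose.rowLens := by
  have hcard : μ.card = n := by
    rw [← μ.sum_rowLens, ← P.parts_sum, h, Multiset.sum_coe]
  have hIcc : (Finset.Icc 1 n).val = (Finset.range n).val.map (· + 1) := by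
    have : Finset.Icc 1 n = (Finset.range n).map (addRightEmbedding 1) := by
      ext i
      simp only [Finset.mem_Icc, Finset.mem_map, Finset.mem_range, addRightEmbedding_apply]
      exact ⟨fun h => ⟨i - 1, by omega, by omega⟩, by rintro ⟨a, ha, rfl⟩; omega⟩
    rw [this]
    rfl
  have hT : (μ.transpose.rowLens : Multiset ℕ) =
      (Finset.range (μ.rowLen 0)).val.map μ.colLen := by
    have : μ.transpose.rowLen = μ.colLen := funext μ.rowLen_transpose
    rw [YoungDiagram.rowLens, this, YoungDiagram.colLen_transpose]
    rfl
  have hfilter : (Finset.range n).filter ((fun m => 0 < m) ∘ μ.colLen) =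
      Finset.range (μ.rowLen 0) := by
    ext j
    have := μ.rowLen_le_card 0
    simp only [Finset.mem_filter, Finset.mem_range, Function.comp_apply]
    rw [← YoungDiagram.mem_iff_lt_colLen, YoungDiagram.mem_iff_lt_rowLen]
    omega
  have hfun : (fun j => (P.parts.filter fun a => j ≤ a).card) ∘ (· + 1) = μ.colLen := by
    funext j
    rw [Function.comp_apply, h, μ.card_filter_rowLens]
  rw [conjParts, hIcc, Multiset.map_map, hfun, Multiset.filter_map, ← Finset.filter_val, hfilter,
    hT]

/-- The Young diagram of a partition. -/
def Nat.Partition.diagram {n : ℕ} (P : n.Partition) : YoungDiagram :=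
  YoungDiagram.ofRowLens (P.parts.sort (· ≥ ·)) (Multiset.pairwise_sort _ _).sortedGE

lemma Nat.Partition.coe_rowLens_diagram {n : ℕ} (P : n.Partition) :
    (P.diagram.rowLens : Multiset ℕ) = P.parts := by
  rw [diagram, YoungDiagram.rowLens_ofRowLens_eq_self, Multiset.sort_eq]
  exact fun x hx => P.parts_pos ((Multiset.mem_sort _).1 hx)

lemma s_eq_encard (n : ℕ) : (s n : ℕ∞) = (selfConjugateDiagrams (2 * n) n).encard := by
  have himage : selfConjugateDiagrams (2 * n) n =
      Nat.Partition.diagram '' {P : n.Partition | P.parts = conjParts P} := by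
    ext μ
    constructor
    · rintro ⟨h1, h2, h3⟩
      have hsum : (μ.rowLens : Multiset ℕ).sum = n := by
        rw [Multiset.sum_coe, μ.sum_rowLens]
        exact_mod_cast h3
      let P : n.Partition := ⟨μ.rowLens, fun hi => μ.pos_of_mem_rowLens _ hi, hsum⟩
      refine ⟨P, ?_, YoungDiagram.eq_of_coe_rowLens_eq P.coe_rowLens_diagram⟩
      change P.parts = conjParts P
      rw [conjParts_eq_rowLens_transpose (P := P) (μ := μ) rfl, h1]
    · rintro ⟨P, hP, rfl⟩
      have hP : P.parts = conjParts P := hP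
      have hcard : P.diagram.card = n := by
        rw [← YoungDiagram.sum_rowLens, ← Multiset.sum_coe, P.coe_rowLens_diagram, P.parts_sum]
      refine ⟨?_, fun h => ?_, by rw [hcard]⟩
      · apply YoungDiagram.eq_of_coe_rowLens_eq
        rw [← conjParts_eq_rowLens_transpose P.coe_rowLens_diagram.symm, ← hP,
          P.coe_rowLens_diagram]
      · have h1 := YoungDiagram.mem_iff_lt_colLen.1 h
        have h2 := P.diagram.colLen_le_card 0
        omega
  rw [himage, Set.InjOn.encard_image]
  · rw [s, ← ENat.card_eq_coe_fintype_card]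
    rfl
  · intro P _ Q _ h
    ext1
    rw [← P.coe_rowLens_diagram, h, Q.coe_rowLens_diagram]

lemma sum_range_four_mul_add_three (N : ℕ) :
    ∑ i ∈ Finset.range N, (4 * i + 3 : ℤ) = 2 * N ^ 2 + N := by
  induction N with
  | zero => simp
  | succ N ih =>
    rw [Finset.sum_range_succ, ih]
    push_cast
    ring

lemma mem_energySubsets_iff {N k : ℕ} {n e : ℤ} (he : 4 * e + (2 * (k - N) ^ 2 - (k - N)) = n)
    {Y : Finset ℕ} (hY : Y.card = k) :
    Y ∈ energySubsets N n ↔ Y ∈ subsetsWithExcess (2 * N) k e := by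
  have hsum : ∑ y ∈ Y, (4 * (y - N) + 1 : ℤ) = 4 * ∑ y ∈ Y, (y : ℤ) - (4 * N - 1) * k := by
    rw [Finset.sum_add_distrib, ← Finset.mul_sum, Finset.sum_sub_distrib]
    simp only [Finset.sum_const, hY, nsmul_eq_mul]
    ring
  simp only [energySubsets, subsetsWithExcess, Set.mem_ofPred_eq, hY, true_and, hsum,
    sum_range_four_mul_add_three]
  refine and_congr_right fun _ => ⟨fun h => ?_, fun h => ?_⟩
  · linarith
  · linarith

lemma nonneg_of_mem_subsetsWithExcess {M k : ℕ} {e : ℤ} {Y : Finset ℕ}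
    (hY : Y ∈ subsetsWithExcess M k e) : 0 ≤ e := by
  have hk : k ≤ M := by simpa [hY.2.1] using Finset.card_le_card hY.1
  obtain ⟨a, rfl⟩ := Nat.exists_eq_add_of_le hk
  have h : (boxedMultisets k a e).Nonempty := by
    rw [← Set.encard_pos, ← encard_subsetsWithExcess, Set.encard_pos]
    exact ⟨Y, hY⟩
  obtain ⟨m, hm⟩ := h
  rw [← hm.2.2]
  exact Int.natCast_nonneg _

/-- The `r` for which `r (r + 1) / 2 = 2 (k - n) ^ 2 - (k - n)`. -/
def triangularIndex (n k : ℕ) : ℕ := if k ≤ n then 2 * (n - k) else 2 * (k - n) - 1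

lemma triangle_triangularIndex (n k : ℕ) :
    ((triangularIndex n k * (triangularIndex n k + 1) / 2 : ℕ) : ℤ) =
      2 * ((k : ℤ) - n) ^ 2 - (k - n) := by
  rw [triangularIndex]
  split_ifs with h
  · obtain ⟨d, rfl⟩ := Nat.exists_eq_add_of_le h
    rw [Nat.add_sub_cancel_left, mul_assoc, Nat.mul_div_cancel_left _ two_pos]
    push_cast
    ring
  · obtain ⟨d, rfl⟩ := Nat.exists_eq_add_of_lt (not_le.1 h)
    have : 2 * (n + d + 1 - n) - 1 = 2 * d + 1 := by omega
    rw [this, show (2 * d + 1) * (2 * d + 1 + 1) = 2 * ((2 * d + 1) * (d + 1)) by ring,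
      Nat.mul_div_cancel_left _ two_pos]
    push_cast
    ring

lemma le_triangle (r : ℕ) : r ≤ r * (r + 1) / 2 := by
  rw [Nat.le_div_iff_mul_le two_pos]
  rcases r with _ | r
  · simp
  · exact Nat.mul_le_mul_left _ (by omega)

lemma exists_triangularIndex_eq {n r : ℕ} (hr : r ≤ n) :
    ∃ k ≤ 2 * n, triangularIndex n k = r ∧
      ∀ k' ≤ 2 * n, triangularIndex n k' = r → k' = k := by
  rcases Nat.even_or_odd' r with ⟨i, rfl | rfl⟩
  · refine ⟨n - i, by omega, ?_, fun k' _ h => ?_⟩ <;> grind [triangularIndex]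
  · refine ⟨n + i + 1, by omega, ?_, fun k' _ h => ?_⟩ <;> grind [triangularIndex]

open Classical in
lemma encard_energySubsets (n : ℕ) :
    (energySubsets n n).encard = ((∑ r ∈ (Finset.range (n + 1)).filter
        (fun r => r * (r + 1) / 2 ≤ n ∧ 4 ∣ (n - r * (r + 1) / 2)),
      p ((n - r * (r + 1) / 2) / 4) : ℕ) : ℕ∞) := by
  set E : Finset (Finset ℕ) := (Finset.range (2 * n)).powerset.filter (· ∈ energySubsets n n)
    with hE
  have hmemE : ∀ Y, Y ∈ E ↔ Y ∈ energySubsets n n := fun Y => by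
    simpa [hE] using fun h : Y ∈ energySubsets n n => h.1
  have hcardE : ∀ Y ∈ E, Y.card ≤ 2 * n := fun Y hY => by
    simpa using Finset.card_le_card ((hmemE Y).1 hY).1
  have hcoe : (energySubsets n n) = (E : Set (Finset ℕ)) := by
    ext Y
    simp [hmemE]
  rw [hcoe, Set.encard_coe_eq_coe_finsetCard, Nat.cast_inj]
  rw [Finset.card_eq_sum_card_fiberwise (f := fun Y => triangularIndex n Y.card)
    (t := (Finset.range (n + 1)).filter
        (fun r => r * (r + 1) / 2 ≤ n ∧ 4 ∣ (n - r * (r + 1) / 2)))]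
  · refine Finset.sum_congr rfl fun r hr => ?_
    obtain ⟨-, hle, hdvd⟩ := Finset.mem_filter.1 hr
    have hrle := le_triangle r
    obtain ⟨k, hk, hkr, hk'⟩ := exists_triangularIndex_eq (hrle.trans hle)
    have htri := triangle_triangularIndex n k
    rw [hkr] at htri
    obtain ⟨e, he⟩ := hdvd
    have hdiv : (n - r * (r + 1) / 2) / 4 = e := by omega
    have hene : 4 * (e : ℤ) + (2 * ((k : ℤ) - n) ^ 2 - (k - n)) = n := by omega
    have hfiber : ((E.filter fun Y => triangularIndex n Y.card = r : Finset (Finset ℕ)) :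
        Set (Finset ℕ)) = subsetsWithExcess (2 * n) k e := by
      ext Y
      simp only [Finset.coe_filter, Set.mem_ofPred_eq]
      constructor
      · rintro ⟨hY, hYr⟩
        exact (mem_energySubsets_iff hene (hk' _ (hcardE Y hY) hYr)).1 ((hmemE Y).1 hY)
      · intro hY
        exact ⟨(hmemE Y).2 ((mem_energySubsets_iff hene hY.2.1).2 hY), by rw [hY.2.1, hkr]⟩
    have hbound : k ≤ n + r ∧ n ≤ k + r := by
      rw [← hkr, triangularIndex]
      split_ifs <;> omega
    obtain ⟨a, ha⟩ := Nat.exists_eq_add_of_le hk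
    rw [← Nat.cast_inj (R := ℕ∞), ← Set.encard_coe_eq_coe_finsetCard, hfiber, ha,
      encard_subsetsWithExcess, hdiv, encard_boxedMultisets] <;> omega
  · intro Y hY
    have hYE : Y ∈ E := hY
    have hYe := (hmemE Y).1 hYE
    have htri := triangle_triangularIndex n Y.card
    have hrle := le_triangle (triangularIndex n Y.card)
    have hsum := hYe.2
    obtain ⟨c, hc⟩ : Even ((Y.card : ℤ) * (Y.card - 1)) := Int.even_mul_pred_self _
    have hene : 4 * (∑ y ∈ Y, (y : ℤ) - c) +
        (2 * ((Y.card : ℤ) - n) ^ 2 - (Y.card - n)) = n := by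
      rw [Finset.sum_add_distrib, ← Finset.mul_sum, Finset.sum_sub_distrib,
        sum_range_four_mul_add_three] at hsum
      simp only [Finset.sum_const, nsmul_eq_mul] at hsum
      linarith
    have hnonneg := nonneg_of_mem_subsetsWithExcess ((mem_energySubsets_iff hene rfl).1 hYe)
    simp only [Finset.coe_filter, Finset.mem_range, Set.mem_ofPred_eq]
    rw [← htri] at hene
    omega

/-- `s n = ∑_r p((n − r(r+1)/2)/4)`, the sum being over all non-negative integers `r` such
that `n − r(r+1)/2` is a non-negative integer divisible by `4`. -/
theorem selfConjugate_count (n : ℕ) :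
    s n = ∑ r ∈ (Finset.range (n + 1)).filter
        (fun r => r * (r + 1) / 2 ≤ n ∧ 4 ∣ (n - r * (r + 1) / 2)),
      p ((n - r * (r + 1) / 2) / 4) := by
  rw [← Nat.cast_inj (R := ℕ∞), s_eq_encard, encard_selfConjugateDiagrams, encard_oddSumSubsets,
    encard_energySubsets]
end
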